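/- arXiv:2312.06469 — 4 statements merged into one kernel-verified Lean document; each statement's English description precedes it below -/
import Mathlib

section
/- (Discretisation of μ) Let μ ∈ M_∞ with F_∞(μ) < +∞ and let λ = λ(L) ↓ 1 as L → ∞. Then there exists a sequence (μ^L) ⊂ M_∞^λ with the following properties: (i) μ^L = Σ_{k∈πℤ/L} b̄^L(x,k) (L¹⌐(0,λ)) × δ_k with b̄^L(·,k) ∈ W^{1,1}(0,λ) and Σ_{k∈πℤ/L} b̄^L(x,k) = 2x for all x ∈ (0,λ), and F_∞^λ(μ^L) = ∫_0^λ Σ_{k∈πℤ/L} k² b̄^L(x,k) dx + ∫_0^λ Σ_{k∈πℤ/L, k≠0} (1/(4k²)) (b̄^L_{,x}(x,k))²/b̄^L(x,k) dx; (ii) (μ^L, μ^L_{,x})⌐((0,1)×ℝ) converges weakly-* to (μ, μ_{,x}); (iii) limsup_{L→∞} F_∞^λ(μ^L) ≤ F_∞(μ). -/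
open MeasureTheory Set Filter Topology
open scoped ENNReal

noncomputable section

/-- The open strip `(-1,1) × ℝ`. -/
def Strip : Set (ℝ × ℝ) := Ioo (-1 : ℝ) 1 ×ˢ (univ : Set ℝ)

/-- Smooth test functions compactly supported in a set `A ⊆ ℝ²`. -/
def IsTest2D (A : Set (ℝ × ℝ)) (φ : ℝ × ℝ → ℝ) : Prop :=
  ContDiff ℝ (⊤ : ℕ∞) φ ∧ HasCompactSupport φ ∧ tsupport φ ⊆ A

/-- Smooth test functions compactly supported in the strip. -/
def IsTest (φ : ℝ × ℝ → ℝ) : Prop := IsTest2D Strip φ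

/-- 1D smooth test functions compactly supported in `I ⊆ ℝ`. -/
def IsTest1D (I : Set ℝ) (φ : ℝ → ℝ) : Prop :=
  ContDiff ℝ (⊤ : ℕ∞) φ ∧ HasCompactSupport φ ∧ tsupport φ ⊆ I

/-- Integral of `f` against a signed measure. -/
def sInt (s : SignedMeasure (ℝ × ℝ)) (f : ℝ × ℝ → ℝ) : ℝ :=
  (∫ p, f p ∂s.toJordanDecomposition.posPart) - ∫ p, f p ∂s.toJordanDecomposition.negPart

/-- Integral of `f` against a signed measure restricted to `A`. -/
def sIntOn (s : SignedMeasure (ℝ × ℝ)) (A : Set (ℝ × ℝ)) (f : ℝ × ℝ → ℝ) : ℝ :=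
  (∫ p in A, f p ∂s.toJordanDecomposition.posPart) -
    ∫ p in A, f p ∂s.toJordanDecomposition.negPart

/-- The partial derivative in the `x`-direction of a function on `ℝ²`. -/
def dX (φ : ℝ × ℝ → ℝ) (p : ℝ × ℝ) : ℝ := fderiv ℝ φ p (1, 0)

/-- A pair `(μ, μ_{,x})` consisting of a positive measure together with (a candidate for)
its distributional `x`-derivative. -/
structure MeasPair where
  mu : Measure (ℝ × ℝ)
  mux : SignedMeasure (ℝ × ℝ)

/-- The class `M_∞`: bounded positive measures on `(-1,1) × ℝ` vanishing on `(-1,0] × ℝ`,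
whose distributional `x`-derivative is a bounded measure, absolutely continuous w.r.t. `μ`,
and satisfying the constraint `∫ φ(x) dμ = ∫ 2xφ(x) dx`. -/
def MemMInfty (P : MeasPair) : Prop :=
  IsFiniteMeasure P.mu ∧
  P.mu Stripᶜ = 0 ∧
  P.mu ((Ioc (-1 : ℝ) 0) ×ˢ (univ : Set ℝ)) = 0 ∧
  (∀ φ : ℝ × ℝ → ℝ, IsTest φ → sInt P.mux φ = - ∫ p, dX φ p ∂P.mu) ∧
  P.mux.totalVariation ≪ P.mu ∧
  (∀ φ : ℝ → ℝ, IsTest1D (Ioo (0 : ℝ) 1) φ →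
    ∫ p in Ioo (0 : ℝ) 1 ×ˢ (univ : Set ℝ), φ p.1 ∂P.mu = ∫ x in Ioo (0 : ℝ) 1, 2 * x * φ x)

/-- The limit functional `F_∞`. -/
def Finfty (P : MeasPair) : ℝ≥0∞ :=
  ∫⁻ p in Ioo (0 : ℝ) 1 ×ˢ (univ : Set ℝ),
    ENNReal.ofReal (p.2 ^ 2 + 1 / (4 * p.2 ^ 2) * (P.mux.rnDeriv P.mu p) ^ 2) ∂P.mu

/-- The class `M_∞^λ` of measures on `(0,λ) × ℝ`. -/
def MemMInftyLam (lam : ℝ) (P : MeasPair) : Prop :=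
  IsFiniteMeasure P.mu ∧
  P.mu ((Ioo (0 : ℝ) lam ×ˢ (univ : Set ℝ))ᶜ) = 0 ∧
  (∀ φ : ℝ × ℝ → ℝ, IsTest2D (Ioo (0 : ℝ) lam ×ˢ (univ : Set ℝ)) φ →
      sInt P.mux φ = - ∫ p, dX φ p ∂P.mu) ∧
  P.mux.totalVariation ≪ P.mu ∧
  (∀ φ : ℝ → ℝ, IsTest1D (Ioo (0 : ℝ) lam) φ →
    ∫ x in Ioo (0 : ℝ) lam, 2 * x * φ x =
      ∫ p in Ioo (0 : ℝ) lam ×ˢ (univ : Set ℝ), φ p.1 ∂P.mu)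

/-- The functional `F_∞^λ`. -/
def FinftyLam (lam : ℝ) (P : MeasPair) : ℝ≥0∞ :=
  ∫⁻ p in Ioo (0 : ℝ) lam ×ˢ (univ : Set ℝ),
    ENNReal.ofReal (p.2 ^ 2 + 1 / (4 * p.2 ^ 2) * (P.mux.rnDeriv P.mu p) ^ 2) ∂P.mu

/-- Weak partial derivative in direction `v` on the strip `(-1,1) × ℝ`. -/
def HasWeakPartial (v : ℝ × ℝ) (u g : ℝ × ℝ → ℝ) : Prop :=
  ∀ φ : ℝ × ℝ → ℝ, IsTest φ →
    ∫ p in Strip, u p * (fderiv ℝ φ p v) = - ∫ p in Strip, g p * φ p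

/-- Weak derivative on an interval `I ⊆ ℝ`. -/
def HasWeakDerivOn1D (I : Set ℝ) (g g' : ℝ → ℝ) : Prop :=
  ∀ φ : ℝ → ℝ, IsTest1D I φ →
    ∫ x in I, g x * deriv φ x = - ∫ x in I, g' x * φ x

/-- One periodicity cell `(-1,1) × (-L,L]`. -/
def Cell (L : ℝ) : Set (ℝ × ℝ) := Ioo (-1 : ℝ) 1 ×ˢ Ioc (-L) L

/-- An out-of-plane displacement together with its (weak) partial derivatives. -/
structure OutData where
  u : ℝ × ℝ → ℝ
  ux : ℝ × ℝ → ℝ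
  uy : ℝ × ℝ → ℝ
  uxx : ℝ × ℝ → ℝ
  uxy : ℝ × ℝ → ℝ
  uyy : ℝ × ℝ → ℝ

/-- Membership in `A_L^out`: `2L`-periodicity in `y` together with `W^{2,2}` regularity:
the bundled functions are the weak partial derivatives and all of them are square
integrable on a periodicity cell. -/
def MemALout (L : ℝ) (d : OutData) : Prop :=
  (∀ x y : ℝ, d.u (x, y + 2 * L) = d.u (x, y)) ∧
  HasWeakPartial (1, 0) d.u d.ux ∧ HasWeakPartial (0, 1) d.u d.uy ∧
  HasWeakPartial (1, 0) d.ux d.uxx ∧ HasWeakPartial (0, 1) d.ux d.uxy ∧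
  HasWeakPartial (0, 1) d.uy d.uyy ∧
  MemLp d.u 2 (volume.restrict (Cell L)) ∧ MemLp d.ux 2 (volume.restrict (Cell L)) ∧
  MemLp d.uy 2 (volume.restrict (Cell L)) ∧ MemLp d.uxx 2 (volume.restrict (Cell L)) ∧
  MemLp d.uxy 2 (volume.restrict (Cell L)) ∧ MemLp d.uyy 2 (volume.restrict (Cell L))

/-- An in-plane displacement together with its (weak) partial derivatives. -/
structure InData where
  w1 : ℝ × ℝ → ℝ
  w2 : ℝ × ℝ → ℝ
  w1x : ℝ × ℝ → ℝ
  w1y : ℝ × ℝ → ℝ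
  w2x : ℝ × ℝ → ℝ
  w2y : ℝ × ℝ → ℝ

/-- Membership in `A_L^in`. -/
def MemALin (L : ℝ) (d : InData) : Prop :=
  (∀ x y : ℝ, d.w1 (x, y + 2 * L) = d.w1 (x, y)) ∧
  (∀ x y : ℝ, d.w2 (x, y + 2 * L) = d.w2 (x, y)) ∧
  HasWeakPartial (1, 0) d.w1 d.w1x ∧ HasWeakPartial (0, 1) d.w1 d.w1y ∧
  HasWeakPartial (1, 0) d.w2 d.w2x ∧ HasWeakPartial (0, 1) d.w2 d.w2y ∧
  MemLp d.w1 2 (volume.restrict (Cell L)) ∧ MemLp d.w2 2 (volume.restrict (Cell L)) ∧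
  MemLp d.w1x 2 (volume.restrict (Cell L)) ∧ MemLp d.w1y 2 (volume.restrict (Cell L)) ∧
  MemLp d.w2x 2 (volume.restrict (Cell L)) ∧ MemLp d.w2y 2 (volume.restrict (Cell L))

/-- The rescaled elastic energy `E_L` (an average over `y ∈ (-L,L)` of an integral
over `x ∈ (-1,1)`). -/
def energyEL (L : ℝ) (w : InData) (d : OutData) : ℝ :=
  (2 * L)⁻¹ * ∫ p in Cell L,
    (((w.w1x p + (d.ux p) ^ 2 / (2 * L ^ 2) - 1) ^ 2 - 1)
      + (w.w2y p + (d.uy p) ^ 2 / 2 - p.1) ^ 2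
      + (L ^ 2)⁻¹ * (L ^ 2 * w.w1y p + w.w2x p + d.ux p * d.uy p) ^ 2
      + (L ^ 2)⁻¹ * ((d.ux p) ^ 2 + (d.uyy p) ^ 2)
      + (L ^ 4)⁻¹ * (2 * (d.uxy p) ^ 2 + (L ^ 2)⁻¹ * (d.uxx p) ^ 2))

/-- The rescaled excess energy `F_L = L² (E_L + 5/3)`. -/
def FL (L : ℝ) (w : InData) (d : OutData) : ℝ := L ^ 2 * (energyEL L w d + 5 / 3)

/-- The frequency `k = π m / L`. -/
def Freq (L : ℝ) (m : ℤ) : ℝ := Real.pi * (m : ℝ) / L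

/-- The Fourier coefficient `a_k(x)` of `u(x,·)`. -/
def fourierCoef (L : ℝ) (u : ℝ × ℝ → ℝ) (k x : ℝ) : ℝ :=
  if 0 < k then Real.sqrt 2 * ((2 * L)⁻¹ * ∫ y in Ioc (-L) L, u (x, y) * Real.sin (k * y))
  else if k < 0 then Real.sqrt 2 * ((2 * L)⁻¹ * ∫ y in Ioc (-L) L, u (x, y) * Real.cos (k * y))
  else (2 * L)⁻¹ * ∫ y in Ioc (-L) L, u (x, y)

/-- The weight `a(x,k) = k² a_k(x)²` at frequency `k = πm/L`. -/
def aWeight (L : ℝ) (u : ℝ × ℝ → ℝ) (m : ℤ) (x : ℝ) : ℝ :=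
  (Freq L m) ^ 2 * (fourierCoef L u (Freq L m) x) ^ 2

/-- Pairing of the measure `μ^L(u) = Σ_k k² a_k(x)² (L¹⌐(-1,1)) × δ_k` with `φ`. -/
def muLpair (L : ℝ) (u : ℝ × ℝ → ℝ) (φ : ℝ × ℝ → ℝ) : ℝ :=
  ∑' m : ℤ, ∫ x in Ioo (-1 : ℝ) 1, aWeight L u m x * φ (x, Freq L m)

/-- Pairing of the distributional `x`-derivative `μ^L_{,x}(u)` with `φ`. -/
def muLxpair (L : ℝ) (u : ℝ × ℝ → ℝ) (φ : ℝ × ℝ → ℝ) : ℝ :=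
  ∑' m : ℤ, ∫ x in Ioo (-1 : ℝ) 1, deriv (aWeight L u m) x * φ (x, Freq L m)

/-- Convergence of `(w, u)` (indexed over a filter) to `μ ∈ M_∞` in the sense of
weak-* convergence of `(μ^L(u), μ^L_{,x}(u))` to `(μ, μ_{,x})`. -/
def ConvTo {ι : Type*} (l : Filter ι) (Lf : ι → ℝ) (uf : ι → (ℝ × ℝ → ℝ)) (P : MeasPair) :
    Prop :=
  ∀ φ : ℝ × ℝ → ℝ, Continuous φ → HasCompactSupport φ →
    Tendsto (fun i => muLpair (Lf i) (uf i) φ) l (𝓝 (∫ p, φ p ∂P.mu)) ∧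
    Tendsto (fun i => muLxpair (Lf i) (uf i) φ) l (𝓝 (sInt P.mux φ))

/-- Disintegration of `μ` in the `x`-variable on `I × ℝ` as `(ν_x, g(x))`. -/
def IsDisintegrationX (I : Set ℝ) (μ : Measure (ℝ × ℝ)) (ν : ℝ → Measure ℝ) (g : ℝ → ℝ) :
    Prop :=
  (∀ s : Set ℝ, MeasurableSet s → Measurable fun x => ν x s) ∧
  (∀ x ∈ I, ν x (univ : Set ℝ) = 1) ∧
  IntegrableOn g I ∧
  ∀ f : ℝ × ℝ → ℝ, Integrable f μ →
    ∫ p in I ×ˢ (univ : Set ℝ), f p ∂μ = ∫ x in I, (∫ k, f (x, k) ∂(ν x)) * g x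

/-- Disintegration of `μ` in the `k`-variable as `(λ, (g_k))`. -/
def IsDisintegrationK (I : Set ℝ) (μ : Measure (ℝ × ℝ)) (lamm : Measure ℝ)
    (g : ℝ → ℝ → ℝ) : Prop :=
  Measurable (Function.uncurry g) ∧
  (∀ᵐ k ∂lamm, ∫ x in I, g k x = 1) ∧
  ∀ f : ℝ × ℝ → ℝ, Integrable f μ →
    ∫ p in I ×ˢ (univ : Set ℝ), f p ∂μ = ∫ k, (∫ x in I, f (x, k) * g k x) ∂lamm

/-- The total variation measure of the pair `τ = (μ, μ_{,x})` (when `μ_{,x} ≪ μ`):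
`d|τ| = √(1 + (dμ_{,x}/dμ)²) dμ`. -/
def tvPair (P : MeasPair) : Measure (ℝ × ℝ) :=
  P.mu.withDensity fun p => ENNReal.ofReal (Real.sqrt (1 + (P.mux.rnDeriv P.mu p) ^ 2))

/-- `A^L(x) = ½ ⨍ (u_{,y}(x,·))² dy`. -/
def ALfun (L : ℝ) (d : OutData) (x : ℝ) : ℝ :=
  (1 / 2) * ((2 * L)⁻¹ * ∫ y in Ioc (-L) L, (d.uy (x, y)) ^ 2)

/-- `f^L(x) = √(x / A^L(x))`. -/
def fLfun (L : ℝ) (d : OutData) (x : ℝ) : ℝ := Real.sqrt (x / ALfun L d x)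

/-- Average in `y` over a period. -/
def avgY (L : ℝ) (F : ℝ × ℝ → ℝ) (x : ℝ) : ℝ := (2 * L)⁻¹ * ∫ y in Ioc (-L) L, F (x, y)

/-- `⨍_{-L}^L ∫_{-1}^1 F dx dy`. -/
def avgCell (L : ℝ) (F : ℝ × ℝ → ℝ) : ℝ := (2 * L)⁻¹ * ∫ p in Cell L, F p

/-- Scaling of a pair `(μ, μ_{,x})` by `α > 0`. -/
def smulPair (α : ℝ) (P : MeasPair) : MeasPair :=
  ⟨ENNReal.ofReal α • P.mu, α • P.mux⟩

/-- Convex combination `t μ₁ + (1-t) μ₂` of pairs. -/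
def combPair (t : ℝ) (P Q : MeasPair) : MeasPair :=
  ⟨ENNReal.ofReal t • P.mu + ENNReal.ofReal (1 - t) • Q.mu, t • P.mux + (1 - t) • Q.mux⟩

/-! ### Signed measures with a density -/

lemma sInt_toSignedMeasure_sub (a b : Measure (ℝ × ℝ)) [IsFiniteMeasure a] [IsFiniteMeasure b]
    {f : ℝ × ℝ → ℝ} (hf : Measurable f) {C : ℝ} (hC : ∀ p, ‖f p‖ ≤ C) :
    sInt (a.toSignedMeasure - b.toSignedMeasure) f = (∫ p, f p ∂a) - ∫ p, f p ∂b := by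
  set s : SignedMeasure (ℝ × ℝ) := a.toSignedMeasure - b.toSignedMeasure with hs
  have key : s.toJordanDecomposition.posPart + b = a + s.toJordanDecomposition.negPart := by
    have h := SignedMeasure.toSignedMeasure_toJordanDecomposition s
    rw [JordanDecomposition.toSignedMeasure] at h
    rw [← Measure.toSignedMeasure_eq_toSignedMeasure_iff, Measure.toSignedMeasure_add,
      Measure.toSignedMeasure_add]
    rw [hs] at h ⊢
    exact sub_eq_sub_iff_add_eq_add.mp h
  have hint : ∀ (ν : Measure (ℝ × ℝ)) [IsFiniteMeasure ν], Integrable f ν := fun ν _ =>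
    Integrable.of_bound hf.aestronglyMeasurable C (Eventually.of_forall hC)
  have h2 := congrArg (fun ν : Measure (ℝ × ℝ) => ∫ p, f p ∂ν) key
  rw [integral_add_measure (hint _) (hint _), integral_add_measure (hint _) (hint _)] at h2
  rw [sInt]
  linarith

lemma sInt_map_withDensity (μ : Measure (ℝ × ℝ)) [IsFiniteMeasure μ] {g : ℝ × ℝ → ℝ}
    (hg : Integrable g μ) (hgm : Measurable g) {T : ℝ × ℝ → ℝ × ℝ} (hT : Measurable T)
    {f : ℝ × ℝ → ℝ} (hf : Measurable f) {C : ℝ} (hC : ∀ p, ‖f p‖ ≤ C) :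
    sInt ((μ.withDensityᵥ g).map T) f = ∫ p, f (T p) * g p ∂μ := by
  have h1 : IsFiniteMeasure (μ.withDensity fun p => ENNReal.ofReal (g p)) :=
    isFiniteMeasure_withDensity_ofReal hg.2
  have h2 : IsFiniteMeasure (μ.withDensity fun p => ENNReal.ofReal (-g p)) :=
    isFiniteMeasure_withDensity_ofReal hg.neg.2
  have hmap : (μ.withDensityᵥ g).map T =
      ((μ.withDensity fun p => ENNReal.ofReal (g p)).map T).toSignedMeasure -
        ((μ.withDensity fun p => ENNReal.ofReal (-g p)).map T).toSignedMeasure := by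
    ext i hi
    rw [VectorMeasure.map_apply _ hT hi,
      withDensityᵥ_eq_withDensity_pos_part_sub_withDensity_neg_part hg]
    simp [hi, hT hi, Measure.toSignedMeasure_apply, measureReal_def, Measure.map_apply hT hi]
  rw [hmap, sInt_toSignedMeasure_sub _ _ hf hC,
    integral_map hT.aemeasurable hf.aestronglyMeasurable,
    integral_map hT.aemeasurable hf.aestronglyMeasurable,
    integral_withDensity_eq_integral_toReal_smul (by fun_prop) (by simp),
    integral_withDensity_eq_integral_toReal_smul (by fun_prop) (by simp), ← integral_sub]
  · refine integral_congr_ae (Eventually.of_forall fun p => ?_)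
    simp only [smul_eq_mul, ENNReal.toReal_ofReal']
    rcases le_total 0 (g p) with h | h
    · rw [max_eq_left h, max_eq_right (by linarith)]; ring
    · rw [max_eq_right h, max_eq_left (by linarith)]; ring
  · simp only [smul_eq_mul, ENNReal.toReal_ofReal']
    exact (hg.pos_part).mul_bdd (c := C) (hf.comp hT).aestronglyMeasurable
      (Eventually.of_forall fun p => hC _)
  · simp only [smul_eq_mul, ENNReal.toReal_ofReal']
    exact (hg.neg_part).mul_bdd (c := C) (hf.comp hT).aestronglyMeasurable
      (Eventually.of_forall fun p => hC _)

lemma withDensity_rnDeriv_of_totalVariation {Q : MeasPair} [IsFiniteMeasure Q.mu]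
    (hac : Q.mux.totalVariation ≪ Q.mu) :
    Q.mu.withDensityᵥ (Q.mux.rnDeriv Q.mu) = Q.mux := by
  apply SignedMeasure.withDensityᵥ_rnDeriv_eq
  rw [SignedMeasure.absolutelyContinuous_ennreal_iff]
  simpa using hac

lemma sInt_eq_integral_rnDeriv {Q : MeasPair} [IsFiniteMeasure Q.mu]
    (hac : Q.mux.totalVariation ≪ Q.mu) {f : ℝ × ℝ → ℝ} (hf : Measurable f) {C : ℝ}
    (hC : ∀ p, ‖f p‖ ≤ C) :
    sInt Q.mux f = ∫ p, f p * Q.mux.rnDeriv Q.mu p ∂Q.mu := by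
  have h := sInt_map_withDensity Q.mu (SignedMeasure.integrable_rnDeriv Q.mux Q.mu)
    (SignedMeasure.measurable_rnDeriv Q.mux Q.mu) measurable_id hf hC
  rwa [VectorMeasure.map_id, withDensity_rnDeriv_of_totalVariation hac] at h

/-! ### Test functions -/

lemma exists_norm_le_of_hasCompactSupport {X : Type*} [TopologicalSpace X] {f : X → ℝ}
    (hf : Continuous f) (hs : HasCompactSupport f) : ∃ C, ∀ x, ‖f x‖ ≤ C :=
  hs.exists_bound_of_continuous hf

lemma isTest2D_mul {I : Set ℝ} {φ ψ : ℝ → ℝ} (hφ : IsTest1D I φ)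
    (hψ : ContDiff ℝ (⊤ : ℕ∞) ψ) (hψs : HasCompactSupport ψ) :
    IsTest2D (I ×ˢ univ) fun p => φ p.1 * ψ p.2 := by
  have hsub : tsupport (fun p : ℝ × ℝ => φ p.1 * ψ p.2) ⊆ tsupport φ ×ˢ tsupport ψ := by
    apply closure_minimal _ ((isClosed_tsupport _).prod (isClosed_tsupport _))
    intro p hp
    rw [Function.mem_support, mul_ne_zero_iff] at hp
    exact ⟨subset_closure hp.1, subset_closure hp.2⟩
  refine ⟨(hφ.1.comp contDiff_fst).mul (hψ.comp contDiff_snd), ?_, ?_⟩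
  · exact (hφ.2.1.isCompact.prod hψs.isCompact).of_isClosed_subset (isClosed_tsupport _) hsub
  · exact fun p hp => ⟨hφ.2.2 (hsub hp).1, mem_univ _⟩

lemma dX_mul {φ ψ : ℝ → ℝ} (hφ : ContDiff ℝ (⊤ : ℕ∞) φ) (hψ : ContDiff ℝ (⊤ : ℕ∞) ψ)
    (p : ℝ × ℝ) : dX (fun p => φ p.1 * ψ p.2) p = deriv φ p.1 * ψ p.2 := by
  have h1 : HasFDerivAt (fun p : ℝ × ℝ => φ p.1) _ p :=
    ((hφ.differentiable (by simp)) p.1).hasDerivAt.hasFDerivAt.comp p hasFDerivAt_fst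
  have h2 : HasFDerivAt (fun p : ℝ × ℝ => ψ p.2) _ p :=
    ((hψ.differentiable (by simp)) p.2).hasDerivAt.hasFDerivAt.comp p hasFDerivAt_snd
  have h3 : HasFDerivAt (fun p : ℝ × ℝ => φ p.1 * ψ p.2) _ p := h1.mul h2
  rw [dX, h3.fderiv]
  simp [mul_comm]

lemma IsTest1D.deriv {I : Set ℝ} {φ : ℝ → ℝ} (hφ : IsTest1D I φ) :
    Continuous (deriv φ) ∧ HasCompactSupport (_root_.deriv φ) :=
  ⟨hφ.1.continuous_deriv (by simp), hφ.2.1.deriv⟩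

lemma dX_eq_deriv {φ : ℝ × ℝ → ℝ} (hφ : ContDiff ℝ (⊤ : ℕ∞) φ) (x k : ℝ) :
    HasDerivAt (fun t => φ (t, k)) (dX φ (x, k)) x := by
  have h1 := ((hφ.differentiable (by simp)) (x, k)).hasFDerivAt
  have h2 : HasDerivAt (fun t : ℝ => (t, k)) ((1 : ℝ), (0 : ℝ)) x :=
    (hasDerivAt_id x).prodMk (hasDerivAt_const x k)
  exact h1.comp_hasDerivAt x h2

lemma IsTest2D.slice {c : ℝ} {φ : ℝ × ℝ → ℝ} (hφ : IsTest2D (Ioo 0 c ×ˢ univ) φ) (hc : 0 < c)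
    (k : ℝ) : IsTest1D (Ioo 0 1) fun x => φ (c * x, k) := by
  have hcl : IsClosedEmbedding fun x : ℝ => (c * x, k) := by
    refine Function.LeftInverse.isClosedEmbedding (f := fun p : ℝ × ℝ => p.1 / c) ?_
      (by fun_prop) (by fun_prop)
    intro x
    simp [hc.ne']
  have hsub : tsupport (fun x => φ (c * x, k)) ⊆ (fun x : ℝ => (c * x, k)) ⁻¹' tsupport φ :=
    tsupport_comp_subset_preimage φ hcl.continuous
  refine ⟨hφ.1.comp (by fun_prop), hφ.2.1.comp_isClosedEmbedding hcl, fun x hx => ?_⟩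
  have h := (hφ.2.2 (hsub hx)).1
  simp only [mem_Ioo] at h ⊢
  exact ⟨by nlinarith [h.1], by nlinarith [h.2]⟩

/-! ### Measures determined by test functions -/

lemma measure_eq_of_test {U : Set ℝ} (hU : IsOpen U) (a b : Measure ℝ) [IsFiniteMeasure a]
    [IsFiniteMeasure b] (ha : a Uᶜ = 0) (hb : b Uᶜ = 0)
    (h : ∀ ψ, IsTest1D U ψ → ∫ x, ψ x ∂a = ∫ x, ψ x ∂b) : a = b := by
  set c := a + b
  have hac : a ≪ c := Measure.absolutelyContinuous_of_le (Measure.le_add_right le_rfl)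
  have hbc : b ≪ c := Measure.absolutelyContinuous_of_le (Measure.le_add_left le_rfl)
  have hda := Measure.integrable_toReal_rnDeriv (μ := a) (ν := c)
  have hdb := Measure.integrable_toReal_rnDeriv (μ := b) (ν := c)
  have hae := hU.ae_eq_zero_of_integral_contDiff_smul_eq_zero
    (f := fun x => (a.rnDeriv c x).toReal - (b.rnDeriv c x).toReal) (μ := c)
    ((hda.sub hdb).integrableOn.locallyIntegrableOn) (by
      intro ψ h1 h2 h3
      obtain ⟨C, hC⟩ := exists_norm_le_of_hasCompactSupport h1.continuous h2
      have e := h ψ ⟨h1, h2, h3⟩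
      rw [← integral_rnDeriv_smul hac, ← integral_rnDeriv_smul hbc] at e
      simp only [smul_eq_mul, mul_sub] at e ⊢
      rw [integral_sub]
      · simp only [mul_comm (ψ _), e, sub_self]
      · exact hda.bdd_mul (c := C) h1.continuous.aestronglyMeasurable (Eventually.of_forall hC)
      · exact hdb.bdd_mul (c := C) h1.continuous.aestronglyMeasurable (Eventually.of_forall hC))
  have hres : a.restrict U = b.restrict U := by
    rw [← Measure.withDensity_rnDeriv_eq a c hac, ← Measure.withDensity_rnDeriv_eq b c hbc,
      restrict_withDensity hU.measurableSet, restrict_withDensity hU.measurableSet]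
    apply withDensity_congr_ae
    rw [EventuallyEq, ae_restrict_iff' hU.measurableSet]
    filter_upwards [hae, a.rnDeriv_lt_top c, b.rnDeriv_lt_top c] with x h1 h2 h3 hx
    exact (ENNReal.toReal_eq_toReal_iff' h2.ne h3.ne).mp (sub_eq_zero.mp (h1 hx))
  rwa [Measure.restrict_eq_self_of_ae_mem (by rw [ae_iff]; exact ha),
    Measure.restrict_eq_self_of_ae_mem (by rw [ae_iff]; exact hb)] at hres

/-! ### The slices of a measure in `M_∞` -/

lemma MemMInfty.ae_fst_mem {P : MeasPair} (hP : MemMInfty P) :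
    ∀ᵐ p ∂P.mu, p.1 ∈ Ioo (0 : ℝ) 1 := by
  rw [ae_iff]
  refine measure_mono_null ?_ (measure_union_null hP.2.1 hP.2.2.1)
  intro p hp
  simp only [mem_ofPred_eq, mem_Ioo, not_and, not_lt] at hp
  simp only [mem_union, Strip, mem_compl_iff, mem_prod, mem_univ, and_true, mem_Ioo, mem_Ioc]
  grind

lemma MemMInfty.setIntegral_snd_preimage {P : MeasPair} (hP : MemMInfty P) {φ : ℝ → ℝ}
    (hφ : IsTest1D (Ioo 0 1) φ) {B : Set ℝ} (hB : MeasurableSet B) :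
    ∫ p in Prod.snd ⁻¹' B, (φ p.1 * P.mux.rnDeriv P.mu p + deriv φ p.1) ∂P.mu = 0 := by
  have := hP.1
  set h := P.mux.rnDeriv P.mu
  have hm : Measurable h := SignedMeasure.measurable_rnDeriv _ _
  have hi : Integrable h P.mu := SignedMeasure.integrable_rnDeriv _ _
  obtain ⟨C, hC⟩ := exists_norm_le_of_hasCompactSupport hφ.1.continuous hφ.2.1
  obtain ⟨D, hD⟩ := exists_norm_le_of_hasCompactSupport hφ.deriv.1 hφ.deriv.2
  have hφm : Measurable fun p : ℝ × ℝ => φ p.1 := hφ.1.continuous.measurable.comp measurable_fst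
  have hφm' : Measurable fun p : ℝ × ℝ => deriv φ p.1 :=
    hφ.deriv.1.measurable.comp measurable_fst
  set G : ℝ × ℝ → ℝ := fun p => φ p.1 * h p + deriv φ p.1 with hG
  have hGm : Measurable G := (hφm.mul hm).add hφm'
  have hφh : Integrable (fun p => φ p.1 * h p) P.mu :=
    hi.bdd_mul (c := C) hφm.aestronglyMeasurable (Eventually.of_forall fun p => hC _)
  have hφ' : Integrable (fun p : ℝ × ℝ => deriv φ p.1) P.mu :=
    Integrable.of_bound hφm'.aestronglyMeasurable D (Eventually.of_forall fun p => hD _)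
  have hGi : Integrable G P.mu := hφh.add hφ'
  have h1 : IsFiniteMeasure (P.mu.withDensity fun p => ENNReal.ofReal (G p)) :=
    isFiniteMeasure_withDensity_ofReal hGi.2
  have h2 : IsFiniteMeasure (P.mu.withDensity fun p => ENNReal.ofReal (-G p)) :=
    isFiniteMeasure_withDensity_ofReal hGi.neg.2
  have key : (P.mu.withDensity fun p => ENNReal.ofReal (G p)).map Prod.snd =
      (P.mu.withDensity fun p => ENNReal.ofReal (-G p)).map Prod.snd := by
    refine measure_eq_of_test isOpen_univ _ _ (by simp) (by simp) fun ψ hψ => ?_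
    obtain ⟨E, hE⟩ := exists_norm_le_of_hasCompactSupport hψ.1.continuous hψ.2.1
    have hψm : Measurable fun p : ℝ × ℝ => ψ p.2 :=
      hψ.1.continuous.measurable.comp measurable_snd
    have htest : IsTest fun p => φ p.1 * ψ p.2 := by
      obtain ⟨t1, t2, t3⟩ := isTest2D_mul hφ hψ.1 hψ.2.1
      exact ⟨t1, t2, t3.trans (prod_mono (Ioo_subset_Ioo (by norm_num) le_rfl) le_rfl)⟩
    have hder := hP.2.2.2.1 _ htest
    obtain ⟨F, hF⟩ := exists_norm_le_of_hasCompactSupport htest.1.continuous htest.2.1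
    have hm2 : Measurable fun p : ℝ × ℝ => φ p.1 * ψ p.2 := hφm.mul hψm
    rw [sInt_eq_integral_rnDeriv hP.2.2.2.2.1 hm2 hF] at hder
    simp only [dX_mul hφ.1 hψ.1] at hder
    rw [integral_map measurable_snd.aemeasurable hψ.1.continuous.aestronglyMeasurable,
      integral_map measurable_snd.aemeasurable hψ.1.continuous.aestronglyMeasurable,
      integral_withDensity_eq_integral_toReal_smul (by fun_prop) (by simp),
      integral_withDensity_eq_integral_toReal_smul (by fun_prop) (by simp), ← sub_eq_zero,
      ← integral_sub]
    · calc _ = ∫ p, (φ p.1 * ψ p.2 * h p + deriv φ p.1 * ψ p.2) ∂P.mu := by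
            refine integral_congr_ae (Eventually.of_forall fun p => ?_)
            have e : max (G p) 0 - max (-G p) 0 = φ p.1 * h p + deriv φ p.1 :=
              max_zero_sub_max_neg_zero_eq_self _
            simp only [smul_eq_mul, ENNReal.toReal_ofReal', ← sub_mul, e]
            ring
        _ = 0 := by
            rw [integral_add, hder]
            · ring
            · exact hi.bdd_mul (c := F) (hφm.mul hψm).aestronglyMeasurable
                (Eventually.of_forall fun p => hF _)
            · exact hφ'.mul_bdd (c := E) hψm.aestronglyMeasurable
                (Eventually.of_forall fun p => hE _)
    · simp only [smul_eq_mul, ENNReal.toReal_ofReal']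
      exact (hGi.pos_part).mul_bdd (c := E) hψm.aestronglyMeasurable
        (Eventually.of_forall fun p => hE _)
    · simp only [smul_eq_mul, ENNReal.toReal_ofReal']
      exact (hGi.neg_part).mul_bdd (c := E) hψm.aestronglyMeasurable
        (Eventually.of_forall fun p => hE _)
  have hB' : MeasurableSet (Prod.snd ⁻¹' B : Set (ℝ × ℝ)) := measurable_snd hB
  have e := congrArg (fun ν : Measure ℝ => ν B) key
  simp only [Measure.map_apply measurable_snd hB, withDensity_apply _ hB'] at e
  rw [integral_eq_lintegral_pos_part_sub_lintegral_neg_part hGi.integrableOn, e, sub_self]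

/-! ### Rounding of the frequencies, and the discretised pair -/

/-- Index of the frequency in `πℤ/L` obtained from `k` by rounding away from zero. -/
def roundAway (L k : ℝ) : ℤ :=
  if k < 0 then ⌊k * L / Real.pi⌋ else ⌈k * L / Real.pi⌉

lemma measurable_roundAway (L : ℝ) : Measurable (roundAway L) := by
  unfold roundAway
  refine Measurable.ite measurableSet_Iio ?_ ?_
  · exact Int.measurable_floor.comp (by fun_prop)
  · exact Int.measurable_ceil.comp (by fun_prop)

lemma measurable_Freq (L : ℝ) : Measurable (Freq L) := measurable_from_top

lemma Freq_injective {L : ℝ} (hL : 0 < L) : Function.Injective (Freq L) := by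
  intro m n h
  simp only [Freq] at h
  have := Real.pi_pos
  field_simp at h
  exact_mod_cast h

lemma Freq_eq_zero_iff {L : ℝ} (hL : 0 < L) {m : ℤ} : Freq L m = 0 ↔ m = 0 := by
  simp [Freq, hL.ne', Real.pi_ne_zero]

lemma pi_div_le_abs_sub_Freq {L : ℝ} (hL : 0 < L) {m n : ℤ} (h : m ≠ n) :
    Real.pi / L ≤ |Freq L m - Freq L n| := by
  have e : Freq L m - Freq L n = Real.pi / L * ((m - n : ℤ) : ℝ) := by
    rw [Freq, Freq]; push_cast; ring
  have h1 : (1 : ℝ) ≤ |((m - n : ℤ) : ℝ)| := by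
    rw [← Int.cast_abs]
    exact_mod_cast Int.one_le_abs (sub_ne_zero.mpr h)
  have h2 : 0 < Real.pi / L := by positivity
  rw [e, abs_mul, abs_of_pos h2]
  nlinarith

lemma Freq_roundAway_of_neg {L k : ℝ} (hL : 0 < L) (hk : k < 0) :
    Freq L (roundAway L k) ≤ k ∧ k - Real.pi / L ≤ Freq L (roundAway L k) := by
  have hpi := Real.pi_pos
  rw [roundAway, if_pos hk, Freq]
  have h1 := Int.floor_le (k * L / Real.pi)
  have h2 := (Int.sub_one_lt_floor (k * L / Real.pi)).le
  constructor
  · rw [div_le_iff₀ hL]; rw [le_div_iff₀ hpi] at h1; linarith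
  · rw [le_div_iff₀ hL, sub_mul, div_mul_cancel₀ _ hL.ne']
    rw [sub_le_iff_le_add, div_le_iff₀ hpi] at h2; linarith

lemma Freq_roundAway_of_nonneg {L k : ℝ} (hL : 0 < L) (hk : 0 ≤ k) :
    k ≤ Freq L (roundAway L k) ∧ Freq L (roundAway L k) ≤ k + Real.pi / L := by
  have hpi := Real.pi_pos
  rw [roundAway, if_neg hk.not_gt, Freq]
  have h1 := Int.le_ceil (k * L / Real.pi)
  have h2 := (Int.ceil_lt_add_one (k * L / Real.pi)).le
  constructor
  · rw [le_div_iff₀ hL]; rw [div_le_iff₀ hpi] at h1; linarith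
  · rw [div_le_iff₀ hL, add_mul, div_mul_cancel₀ _ hL.ne']
    rw [← sub_le_iff_le_add, le_div_iff₀ hpi] at h2; linarith

lemma abs_Freq_roundAway_sub_le {L : ℝ} (hL : 0 < L) (k : ℝ) :
    |Freq L (roundAway L k) - k| ≤ Real.pi / L := by
  have hpos : 0 < Real.pi / L := by have := Real.pi_pos; positivity
  rw [abs_le]
  rcases lt_or_ge k 0 with hk | hk
  · have := Freq_roundAway_of_neg hL hk; constructor <;> linarith
  · have := Freq_roundAway_of_nonneg hL hk; constructor <;> linarith

lemma sq_le_sq_Freq_roundAway {L : ℝ} (hL : 0 < L) (k : ℝ) :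
    k ^ 2 ≤ Freq L (roundAway L k) ^ 2 := by
  rcases lt_or_ge k 0 with hk | hk
  · nlinarith [Freq_roundAway_of_neg hL hk]
  · nlinarith [Freq_roundAway_of_nonneg hL hk]

lemma Freq_roundAway_zero (L : ℝ) : Freq L (roundAway L 0) = 0 := by simp [roundAway, Freq]

/-- Dilation by `c` in `x`, rounding to `πℤ/L` in `k`. -/
def discMap (c L : ℝ) (p : ℝ × ℝ) : ℝ × ℝ := (c * p.1, Freq L (roundAway L p.2))

lemma measurable_discMap (c L : ℝ) : Measurable (discMap c L) :=
  (measurable_fst.const_mul c).prodMk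
    ((measurable_Freq L).comp ((measurable_roundAway L).comp measurable_snd))

/-- The push-forward of a pair under `discMap c L`, normalised so that the constraint
`∫ φ(x) dμ = ∫ 2xφ(x) dx` is preserved. -/
def discPair (P : MeasPair) (c L : ℝ) : MeasPair where
  mu := ENNReal.ofReal (c ^ 2) • P.mu.map (discMap c L)
  mux := (P.mu.withDensityᵥ fun p => c * P.mux.rnDeriv P.mu p).map (discMap c L)

lemma integral_discPair_mu (P : MeasPair) (c L : ℝ) {f : ℝ × ℝ → ℝ} (hf : Measurable f) :
    ∫ p, f p ∂(discPair P c L).mu = c ^ 2 * ∫ p, f (discMap c L p) ∂P.mu := by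
  rw [discPair, integral_smul_measure,
    integral_map (measurable_discMap c L).aemeasurable hf.aestronglyMeasurable,
    ENNReal.toReal_ofReal (sq_nonneg c), smul_eq_mul]

lemma lintegral_discPair_mu (P : MeasPair) (c L : ℝ) {f : ℝ × ℝ → ℝ≥0∞} (hf : Measurable f) :
    ∫⁻ p, f p ∂(discPair P c L).mu =
      ENNReal.ofReal (c ^ 2) * ∫⁻ p, f (discMap c L p) ∂P.mu := by
  rw [discPair, lintegral_smul_measure, lintegral_map hf (measurable_discMap c L), smul_eq_mul]

lemma sInt_discPair_mux (P : MeasPair) [IsFiniteMeasure P.mu] (c L : ℝ) {f : ℝ × ℝ → ℝ}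
    (hf : Measurable f) {C : ℝ} (hC : ∀ p, ‖f p‖ ≤ C) :
    sInt (discPair P c L).mux f =
      ∫ p, f (discMap c L p) * (c * P.mux.rnDeriv P.mu p) ∂P.mu :=
  sInt_map_withDensity P.mu ((SignedMeasure.integrable_rnDeriv _ _).const_mul c)
    ((SignedMeasure.measurable_rnDeriv _ _).const_mul c) (measurable_discMap c L) hf hC

lemma ae_discPair_mu {P : MeasPair} {c L : ℝ} {p : ℝ × ℝ → Prop}
    (hp : MeasurableSet {x | p x}) (h : ∀ᵐ x ∂P.mu, p (discMap c L x)) :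
    ∀ᵐ x ∂(discPair P c L).mu, p x := by
  have h1 : ∀ᵐ x ∂(P.mu.map (discMap c L)), p x :=
    (ae_map_iff (measurable_discMap c L).aemeasurable hp).mpr h
  exact Measure.ae_smul_measure h1 _

lemma discPair_mu_ae_fst {P : MeasPair} (hP : MemMInfty P) {c : ℝ} (hc : 0 < c) (L : ℝ) :
    ∀ᵐ p ∂(discPair P c L).mu, p.1 ∈ Ioo 0 c := by
  refine ae_discPair_mu (measurable_fst measurableSet_Ioo) ?_
  filter_upwards [hP.ae_fst_mem] with p hp
  simp only [discMap, mem_Ioo] at hp ⊢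
  constructor <;> nlinarith [hp.1, hp.2]

lemma discPair_mu_ae_snd (P : MeasPair) (c L : ℝ) :
    ∀ᵐ p ∂(discPair P c L).mu, ∃ m, Freq L m = p.2 := by
  refine ae_discPair_mu ?_ (Eventually.of_forall fun p => ⟨_, rfl⟩)
  exact measurable_snd (countable_range (Freq L)).measurableSet

lemma discPair_mu_integral_deriv {P : MeasPair} (hP : MemMInfty P) {c L : ℝ} (hc : 0 < c)
    {φ : ℝ × ℝ → ℝ} (hφ : IsTest2D (Ioo 0 c ×ˢ univ) φ) :
    sInt (discPair P c L).mux φ = - ∫ p, dX φ p ∂(discPair P c L).mu := by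
  have := hP.1
  set h := P.mux.rnDeriv P.mu with hh
  have hi : Integrable h P.mu := SignedMeasure.integrable_rnDeriv _ _
  have hφc := hφ.1.continuous
  have hdc : Continuous (dX φ) := by
    have : Continuous (fderiv ℝ φ) := hφ.1.continuous_fderiv (by simp)
    exact this.clm_apply continuous_const
  have hds : HasCompactSupport (dX φ) :=
    (hφ.2.1.fderiv ℝ).comp_left (g := fun A : ℝ × ℝ →L[ℝ] ℝ => A (1, 0)) (by simp)
  obtain ⟨C, hC⟩ := exists_norm_le_of_hasCompactSupport hφc hφ.2.1
  obtain ⟨D, hD⟩ := exists_norm_le_of_hasCompactSupport hdc hds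
  have hT := measurable_discMap c L
  rw [sInt_discPair_mux P c L hφc.measurable hC, integral_discPair_mu P c L hdc.measurable,
    ← integral_const_mul, eq_neg_iff_add_eq_zero]
  have i1 : Integrable (fun p => φ (discMap c L p) * (c * h p)) P.mu :=
    (hi.const_mul c).bdd_mul (c := C) (hφc.measurable.comp hT).aestronglyMeasurable
      (Eventually.of_forall fun p => hC _)
  have i2 : Integrable (fun p => c ^ 2 * dX φ (discMap c L p)) P.mu :=
    (Integrable.of_bound (hdc.measurable.comp hT).aestronglyMeasurable D
      (Eventually.of_forall fun p => hD _)).const_mul _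
  have i3 : Integrable (fun p => φ (discMap c L p) * (c * h p) +
      c ^ 2 * dX φ (discMap c L p)) P.mu := i1.add i2
  rw [← integral_add i1 i2, ← setIntegral_univ]
  have hU : (univ : Set (ℝ × ℝ)) = ⋃ n : ℤ, Prod.snd ⁻¹' (roundAway L ⁻¹' {n}) := by
    ext p; simp
  have hmeas : ∀ n : ℤ, MeasurableSet (roundAway L ⁻¹' {n}) :=
    fun n => measurable_roundAway L (measurableSet_singleton n)
  rw [hU, integral_iUnion (fun n => measurable_snd (hmeas n)) _ i3.integrableOn]
  · refine (tsum_congr fun n => ?_).trans tsum_zero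
    have hs := hP.setIntegral_snd_preimage (hφ.slice hc (Freq L n)) (hmeas n)
    rw [← mul_zero c, ← hs, ← integral_const_mul]
    refine setIntegral_congr_fun (measurable_snd (hmeas n)) fun p hp => ?_
    have hp' : roundAway L p.2 = n := hp
    have hd : deriv (fun x => φ (c * x, Freq L n)) p.1 = dX φ (c * p.1, Freq L n) * c := by
      have h0 : HasDerivAt (fun x : ℝ => c * x) c p.1 := by
        simpa using (hasDerivAt_id p.1).const_mul c
      exact ((dX_eq_deriv hφ.1 (c * p.1) (Freq L n)).comp p.1 h0).deriv
    simp only [discMap, hp', hd]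
    ring
  · intro m n hmn
    refine Set.disjoint_left.mpr fun p h1 h2 => hmn ?_
    exact (show roundAway L p.2 = m from h1).symm.trans h2

lemma discPair_mu_fst {P : MeasPair} (hP : MemMInfty P) {c : ℝ} (hc : 0 < c) (L : ℝ)
    {φ : ℝ → ℝ} (hφ : IsTest1D (Ioo 0 c) φ) :
    ∫ p, φ p.1 ∂(discPair P c L).mu = ∫ x in Ioo 0 c, 2 * x * φ x := by
  have hφ2 : IsTest1D (Ioo 0 1) fun x => φ (c * x) := by
    have hcl : IsClosedEmbedding fun x : ℝ => c * x :=
      (Homeomorph.mulLeft₀ c hc.ne').isClosedEmbedding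
    refine ⟨hφ.1.comp (by fun_prop), hφ.2.1.comp_isClosedEmbedding hcl, fun x hx => ?_⟩
    have h := hφ.2.2 (tsupport_comp_subset_preimage φ hcl.continuous hx)
    simp only [mem_Ioo] at h ⊢
    exact ⟨by nlinarith [h.1], by nlinarith [h.2]⟩
  have h1 := hP.2.2.2.2.2 _ hφ2
  rw [Measure.restrict_eq_self_of_ae_mem
    (by filter_upwards [hP.ae_fst_mem] with p hp using ⟨hp, mem_univ _⟩)] at h1
  rw [integral_discPair_mu P c L (f := fun p => φ p.1)
    (hφ.1.continuous.measurable.comp measurable_fst)]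
  simp only [discMap]
  rw [h1, ← integral_Ioc_eq_integral_Ioo, ← integral_Ioc_eq_integral_Ioo,
    ← intervalIntegral.integral_of_le zero_le_one, ← intervalIntegral.integral_of_le hc.le]
  have h2 := intervalIntegral.integral_comp_mul_left (a := 0) (b := 1)
    (fun x => 2 * x * φ x) hc.ne'
  rw [mul_zero, mul_one] at h2
  have h3 : ∫ x in (0 : ℝ)..1, 2 * (c * x) * φ (c * x) =
      c * ∫ x in (0 : ℝ)..1, 2 * x * φ (c * x) := by
    rw [← intervalIntegral.integral_const_mul]
    congr 1; ext x; ring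
  rw [h3, smul_eq_mul] at h2
  field_simp at h2
  linarith

lemma discPair_mem {P : MeasPair} (hP : MemMInfty P) {c : ℝ} (hc : 0 < c) (L : ℝ) :
    MemMInftyLam c (discPair P c L) := by
  have := hP.1
  have hae := discPair_mu_ae_fst hP hc L
  refine ⟨Measure.smul_finite _ ENNReal.ofReal_ne_top, ?_, ?_, ?_, ?_⟩
  · refine measure_mono_null (fun p hp => ?_) hae
    simpa using hp
  · exact fun φ hφ => discPair_mu_integral_deriv hP hc hφ
  · have h1 : (discPair P c L).mux ≪ᵥ (discPair P c L).mu.toENNRealVectorMeasure := by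
      refine VectorMeasure.AbsolutelyContinuous.mk fun s hs h0 => ?_
      have hT := measurable_discMap c L
      rw [Measure.toENNRealVectorMeasure_apply_measurable hs, discPair, Measure.smul_apply,
        smul_eq_mul, mul_eq_zero, Measure.map_apply hT hs] at h0
      have h2 : P.mu (discMap c L ⁻¹' s) = 0 :=
        h0.resolve_left (by simpa using by positivity)
      rw [discPair, VectorMeasure.map_apply _ hT hs]
      rw [withDensityᵥ_apply ((SignedMeasure.integrable_rnDeriv _ _).const_mul c) (hT hs),
        Measure.restrict_eq_zero.mpr h2, integral_zero_measure]
    rw [SignedMeasure.absolutelyContinuous_ennreal_iff] at h1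
    simpa using h1
  · intro φ hφ
    have hr : (discPair P c L).mu.restrict (Ioo 0 c ×ˢ univ) = (discPair P c L).mu :=
      Measure.restrict_eq_self_of_ae_mem
        (by filter_upwards [hae] with p hp using ⟨hp, mem_univ _⟩)
    rw [hr, discPair_mu_fst hP hc L hφ]

/-! ### Slicing a measure carried by countably many lines -/

lemma exists_slice_density {Q : Measure (ℝ × ℝ)} [IsFiniteMeasure Q] {L c : ℝ} (hL : 0 < L)
    (hsnd : ∀ᵐ p ∂Q, ∃ m, Freq L m = p.2)
    (hfst : Q.map Prod.fst =
      (volume.restrict (Ioo 0 c)).withDensity fun x => ENNReal.ofReal (2 * x)) :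
    ∃ b : ℤ → ℝ → ℝ, (∀ m, Measurable (b m)) ∧ (∀ m, ∀ x ∈ Ioo 0 c, 0 ≤ b m x) ∧
      (∀ x ∈ Ioo 0 c, ∑' m, b m x = 2 * x) ∧
      (∀ m, Q.restrict (Prod.snd ⁻¹' {Freq L m}) =
        ((volume.restrict (Ioo 0 c)).withDensity fun x => ENNReal.ofReal (b m x)).map
          fun x => (x, Freq L m)) ∧
      Q = Measure.sum fun m => Q.restrict (Prod.snd ⁻¹' {Freq L m}) := by
  set V : Measure ℝ := volume.restrict (Ioo 0 c)
  set ν : ℤ → Measure ℝ := fun m => (Q.restrict (Prod.snd ⁻¹' {Freq L m})).map Prod.fst with hν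
  have hline : ∀ m, MeasurableSet (Prod.snd ⁻¹' {Freq L m} : Set (ℝ × ℝ)) := fun m =>
    measurable_snd (measurableSet_singleton _)
  have hQ : Q = Measure.sum fun m => Q.restrict (Prod.snd ⁻¹' {Freq L m}) := by
    rw [← Measure.restrict_iUnion _ hline]
    · refine (Measure.restrict_eq_self_of_ae_mem ?_).symm
      filter_upwards [hsnd] with p ⟨m, hm⟩
      exact mem_iUnion.mpr ⟨m, hm.symm⟩
    · intro m n hmn
      refine Set.disjoint_left.mpr fun p h1 h2 => hmn (Freq_injective hL ?_)
      exact (show p.2 = Freq L m from h1).symm.trans h2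
  have hsum : Measure.sum ν = V.withDensity fun x => ENNReal.ofReal (2 * x) := by
    rw [← hfst]
    conv_rhs => rw [hQ]
    rw [Measure.map_sum measurable_fst.aemeasurable]
  have hac : ∀ m, ν m ≪ V := fun m =>
    (Measure.absolutelyContinuous_of_le ((Measure.le_sum ν m).trans hsum.le)).trans
      (withDensity_absolutelyContinuous _ _)
  set f : ℤ → ℝ → ℝ≥0∞ := fun m => (ν m).rnDeriv V
  have hfm : ∀ m, Measurable (f m) := fun m => Measure.measurable_rnDeriv _ _
  have hf : ∀ m, V.withDensity (f m) = ν m := fun m => Measure.withDensity_rnDeriv_eq _ _ (hac m)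
  have htsum : V.withDensity (∑' m, f m) = V.withDensity fun x => ENNReal.ofReal (2 * x) := by
    rw [withDensity_tsum hfm, ← hsum]
    simp only [hf]
  have hSm : Measurable (∑' m, f m) := Measurable.tsum' hfm
  have hae : (∑' m, f m) =ᵐ[V] fun x => ENNReal.ofReal (2 * x) := by
    refine (withDensity_eq_iff hSm.aemeasurable (by fun_prop) ?_).mp htsum
    rw [← setLIntegral_univ, ← withDensity_apply _ MeasurableSet.univ, htsum, ← hfst]
    exact measure_ne_top _ _
  set G : Set ℝ := {x | (∑' m, f m) x = ENNReal.ofReal (2 * x)} with hG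
  have hGm : MeasurableSet G := measurableSet_eq_fun hSm (by fun_prop)
  have hGf : ∀ x ∈ G, ∀ m, f m x ≠ ⊤ := by
    intro x hx m
    have h1 : f m x ≤ (∑' m, f m) x := by
      rw [tsum_apply (Pi.summable.mpr fun _ => ENNReal.summable)]
      exact ENNReal.le_tsum m
    rw [show (∑' m, f m) x = ENNReal.ofReal (2 * x) from hx] at h1
    exact ne_top_of_le_ne_top ENNReal.ofReal_ne_top h1
  classical
  set b : ℤ → ℝ → ℝ := fun m =>
    G.piecewise (fun x => (f m x).toReal) fun x => if m = 0 then 2 * x else 0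
  refine ⟨b, fun m => ?_, fun m x hx => ?_, fun x hx => ?_, fun m => ?_, hQ⟩
  · refine Measurable.piecewise hGm (hfm m).ennreal_toReal ?_
    split_ifs <;> fun_prop
  · by_cases hxG : x ∈ G
    · simp [b, hxG]
    · simp only [b, hxG, not_false_eq_true, piecewise_eq_of_notMem]
      split_ifs
      · linarith [hx.1]
      · exact le_rfl
  · by_cases hxG : x ∈ G
    · simp only [b, hxG, piecewise_eq_of_mem]
      rw [← ENNReal.tsum_toReal_eq (hGf x hxG), ← tsum_apply (Pi.summable.mpr fun _ => ENNReal.summable),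
        show (∑' m, f m) x = ENNReal.ofReal (2 * x) from hxG,
        ENNReal.toReal_ofReal (by linarith [hx.1])]
    · simp [b, hxG]
  · have h1 : (V.withDensity fun x => ENNReal.ofReal (b m x)) = ν m := by
      rw [← hf m]
      refine withDensity_congr_ae ?_
      filter_upwards [hae] with x hx
      have hxG : x ∈ G := hx
      simp only [b, hxG, piecewise_eq_of_mem]
      exact ENNReal.ofReal_toReal (hGf x hxG m)
    rw [h1, hν, Measure.map_map (by fun_prop) measurable_fst]
    conv_lhs => rw [← Measure.map_id (μ := Q.restrict _)]
    refine Measure.map_congr ?_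
    filter_upwards [ae_restrict_mem (hline m)] with p hp
    exact Prod.ext rfl hp

section Slice

variable {Q : Measure (ℝ × ℝ)} {S : Set (ℝ × ℝ)} {I : Set ℝ} {b : ℝ → ℝ} {k : ℝ}

lemma setLIntegral_of_slice (hb : Measurable b)
    (hQ : Q.restrict S =
      ((volume.restrict I).withDensity fun x => ENNReal.ofReal (b x)).map fun x => (x, k))
    {g : ℝ × ℝ → ℝ≥0∞} (hg : Measurable g) :
    ∫⁻ p in S, g p ∂Q = ∫⁻ x in I, g (x, k) * ENNReal.ofReal (b x) := by
  rw [hQ, lintegral_map hg (by fun_prop),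
    lintegral_withDensity_eq_lintegral_mul _ (by fun_prop) (by fun_prop)]
  simp only [Pi.mul_apply, mul_comm]

lemma setIntegral_of_slice (hI : MeasurableSet I) (hb : Measurable b) (hb0 : ∀ x ∈ I, 0 ≤ b x)
    (hQ : Q.restrict S =
      ((volume.restrict I).withDensity fun x => ENNReal.ofReal (b x)).map fun x => (x, k))
    {g : ℝ × ℝ → ℝ} (hg : Measurable g) :
    ∫ p in S, g p ∂Q = ∫ x in I, g (x, k) * b x := by
  rw [hQ, integral_map (by fun_prop) hg.aestronglyMeasurable,
    integral_withDensity_eq_integral_toReal_smul (by fun_prop) (by simp)]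
  refine setIntegral_congr_fun hI fun x hx => ?_
  simp only [ENNReal.toReal_ofReal (hb0 x hx), smul_eq_mul, mul_comm]

lemma integrableOn_of_slice (hI : MeasurableSet I) (hb : Measurable b)
    (hb0 : ∀ x ∈ I, 0 ≤ b x)
    (hQ : Q.restrict S =
      ((volume.restrict I).withDensity fun x => ENNReal.ofReal (b x)).map fun x => (x, k))
    {g : ℝ × ℝ → ℝ} (hg : Measurable g) (hgi : Integrable g Q) :
    IntegrableOn (fun x => g (x, k) * b x) I := by
  refine ⟨by fun_prop, ?_⟩
  have h1 := setLIntegral_of_slice hb hQ hg.enorm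
  have h2 : ∫⁻ x in I, ‖g (x, k) * b x‖ₑ = ∫⁻ x in I, ‖g (x, k)‖ₑ * ENNReal.ofReal (b x) := by
    refine setLIntegral_congr_fun hI fun x hx => ?_
    simp only [enorm_mul, Real.enorm_of_nonneg (hb0 x hx)]
  rw [HasFiniteIntegral, h2, ← h1]
  exact hgi.integrableOn.2

end Slice

lemma hasWeakDerivOn1D_of_slice {c L : ℝ} (hL : 0 < L) {Q : MeasPair}
    (hmem : MemMInftyLam c Q) (hsnd : ∀ᵐ p ∂Q.mu, ∃ m, Freq L m = p.2) {m : ℤ} {b : ℝ → ℝ}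
    (hb : Measurable b) (hb0 : ∀ x ∈ Ioo 0 c, 0 ≤ b x)
    (hQ : Q.mu.restrict (Prod.snd ⁻¹' {Freq L m}) =
      ((volume.restrict (Ioo 0 c)).withDensity fun x => ENNReal.ofReal (b x)).map
        fun x => (x, Freq L m)) :
    HasWeakDerivOn1D (Ioo 0 c) b fun x => Q.mux.rnDeriv Q.mu (x, Freq L m) * b x := by
  intro φ hφ
  have := hmem.1
  have hpos : 0 < Real.pi / L := by have := Real.pi_pos; positivity
  let ψ : ContDiffBump (Freq L m) :=
    ⟨Real.pi / L / 4, Real.pi / L / 2, by positivity, by linarith⟩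
  have hψC : ContDiff ℝ (⊤ : ℕ∞) ψ := ψ.contDiff
  have hφm : Measurable fun p : ℝ × ℝ => φ p.1 := hφ.1.continuous.measurable.comp measurable_fst
  have hφm' : Measurable fun p : ℝ × ℝ => deriv φ p.1 :=
    hφ.deriv.1.measurable.comp measurable_fst
  have hψm : Measurable fun p : ℝ × ℝ => ψ p.2 := hψC.continuous.measurable.comp measurable_snd
  have htest := isTest2D_mul hφ hψC ψ.hasCompactSupport
  obtain ⟨F, hF⟩ := exists_norm_le_of_hasCompactSupport htest.1.continuous htest.2.1
  have hm2 : Measurable fun p : ℝ × ℝ => φ p.1 * ψ p.2 := hφm.mul hψm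
  have h := hmem.2.2.1 _ htest
  rw [sInt_eq_integral_rnDeriv hmem.2.2.2.1 hm2 hF] at h
  simp only [dX_mul hφ.1 hψC] at h
  have hline : MeasurableSet (Prod.snd ⁻¹' {Freq L m} : Set (ℝ × ℝ)) :=
    measurable_snd (measurableSet_singleton _)
  have hind : ∀ g : ℝ × ℝ → ℝ, ∫ p, g p * ψ p.2 ∂Q.mu =
      ∫ p in Prod.snd ⁻¹' {Freq L m}, g p ∂Q.mu := by
    intro g
    rw [← integral_indicator hline]
    refine integral_congr_ae ?_
    filter_upwards [hsnd] with p ⟨n, hn⟩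
    by_cases hp : p ∈ (Prod.snd ⁻¹' {Freq L m} : Set (ℝ × ℝ))
    · rw [indicator_of_mem hp, show p.2 = Freq L m from hp,
        ψ.one_of_mem_closedBall (Metric.mem_closedBall_self ψ.rIn_pos.le), mul_one]
    · rw [indicator_of_notMem hp, ψ.zero_of_le_dist, mul_zero]
      have hmn : n ≠ m := fun e => hp (by rw [← e]; exact hn.symm)
      have h2 := pi_div_le_abs_sub_Freq hL hmn
      rw [← hn, Real.dist_eq]
      change Real.pi / L / 2 ≤ _
      linarith
  have hr : Measurable (Q.mux.rnDeriv Q.mu) := SignedMeasure.measurable_rnDeriv _ _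
  have e1 : ∀ p : ℝ × ℝ, φ p.1 * ψ p.2 * Q.mux.rnDeriv Q.mu p =
      φ p.1 * Q.mux.rnDeriv Q.mu p * ψ p.2 := fun p => by ring
  simp only [e1] at h
  have hm3 : Measurable fun p : ℝ × ℝ => φ p.1 * Q.mux.rnDeriv Q.mu p := hφm.mul hr
  rw [hind fun p => φ p.1 * Q.mux.rnDeriv Q.mu p, hind fun p => deriv φ p.1,
    setIntegral_of_slice measurableSet_Ioo hb hb0 hQ hm3,
    setIntegral_of_slice measurableSet_Ioo hb hb0 hQ hφm'] at h
  have e2 : ∫ x in Ioo 0 c, b x * deriv φ x = ∫ x in Ioo 0 c, deriv φ x * b x := by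
    simp only [mul_comm]
  rw [e2, eq_neg_iff_add_eq_zero, add_comm, ← eq_neg_iff_add_eq_zero, ← h]
  congr 1; ext x
  ring

lemma FinftyLam_eq_of_slice {c L : ℝ} (hL : 0 < L) {Q : MeasPair}
    (hfst : ∀ᵐ p ∂Q.mu, p.1 ∈ Ioo 0 c) {b : ℤ → ℝ → ℝ} (hb : ∀ m, Measurable (b m))
    (hb0 : ∀ m, ∀ x ∈ Ioo 0 c, 0 ≤ b m x)
    (hQ : ∀ m, Q.mu.restrict (Prod.snd ⁻¹' {Freq L m}) =
      ((volume.restrict (Ioo 0 c)).withDensity fun x => ENNReal.ofReal (b m x)).map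
        fun x => (x, Freq L m))
    (hsum : Q.mu = Measure.sum fun m => Q.mu.restrict (Prod.snd ⁻¹' {Freq L m})) :
    FinftyLam c Q =
      (∑' m : ℤ, ∫⁻ x in Ioo 0 c, ENNReal.ofReal (Freq L m ^ 2 * b m x)) +
      (∑' m : ℤ, if m = 0 then 0 else ∫⁻ x in Ioo 0 c,
        ENNReal.ofReal (1 / (4 * Freq L m ^ 2) *
          (Q.mux.rnDeriv Q.mu (x, Freq L m) * b m x) ^ 2 / b m x)) := by
  have hr : Measurable (Q.mux.rnDeriv Q.mu) := SignedMeasure.measurable_rnDeriv _ _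
  set H := Q.mux.rnDeriv Q.mu
  have hgm : Measurable fun p : ℝ × ℝ =>
      ENNReal.ofReal (p.2 ^ 2 + 1 / (4 * p.2 ^ 2) * H p ^ 2) := by fun_prop
  have hres : Q.mu.restrict (Ioo 0 c ×ˢ univ) = Q.mu :=
    Measure.restrict_eq_self_of_ae_mem
      (by filter_upwards [hfst] with p hp using ⟨hp, mem_univ _⟩)
  have e1 : FinftyLam c Q = ∑' m, ∫⁻ p in Prod.snd ⁻¹' {Freq L m},
      ENNReal.ofReal (p.2 ^ 2 + 1 / (4 * p.2 ^ 2) * H p ^ 2) ∂Q.mu := by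
    rw [FinftyLam, hres, ← lintegral_sum_measure, ← hsum]
  rw [e1, ← ENNReal.tsum_add]
  refine tsum_congr fun m => ?_
  rw [setLIntegral_of_slice (hb m) (hQ m) hgm]
  have hbm := hb m
  have hif : (if m = 0 then 0 else ∫⁻ x in Ioo 0 c, ENNReal.ofReal
      (1 / (4 * Freq L m ^ 2) * (H (x, Freq L m) * b m x) ^ 2 / b m x)) =
      ∫⁻ x in Ioo 0 c, ENNReal.ofReal
        (1 / (4 * Freq L m ^ 2) * (H (x, Freq L m) * b m x) ^ 2 / b m x) := by
    split_ifs with h0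
    · simp [(Freq_eq_zero_iff hL).mpr h0]
    · rfl
  rw [hif, ← lintegral_add_left (by fun_prop)]
  refine setLIntegral_congr_fun measurableSet_Ioo fun x hx => ?_
  have hx0 := hb0 m x hx
  simp only
  rw [← ENNReal.ofReal_mul (by positivity), ← ENNReal.ofReal_add (by positivity) (by positivity)]
  congr 1
  rcases hx0.eq_or_lt with h0 | h0
  · simp [← h0]
  · rw [add_mul]
    congr 1
    rw [mul_div_assoc]
    have : (H (x, Freq L m) * b m x) ^ 2 / b m x = H (x, Freq L m) ^ 2 * b m x := by
      field_simp
    rw [this, mul_assoc]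

/-! ### Convergence of the discretised pairs -/

lemma tendsto_Freq_roundAway (k : ℝ) :
    Tendsto (fun L => Freq L (roundAway L k)) atTop (𝓝 k) := by
  have h0 : Tendsto (fun L : ℝ => Real.pi / L) atTop (𝓝 0) := tendsto_const_nhds.div_atTop tendsto_id
  rw [tendsto_iff_dist_tendsto_zero]
  refine squeeze_zero' (Eventually.of_forall fun _ => dist_nonneg) ?_ h0
  filter_upwards [eventually_gt_atTop 0] with L hL
  exact abs_Freq_roundAway_sub_le hL k

lemma tendsto_discMap {lam : ℝ → ℝ} (hlam : Tendsto lam atTop (𝓝 1)) (p : ℝ × ℝ) :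
    Tendsto (fun L => discMap (lam L) L p) atTop (𝓝 p) := by
  have h1 : Tendsto (fun L => lam L * p.1) atTop (𝓝 p.1) := by
    simpa using hlam.mul_const p.1
  exact h1.prodMk_nhds (tendsto_Freq_roundAway p.2)

lemma tendsto_indicator_discMap {lam : ℝ → ℝ} (hlam : Tendsto lam atTop (𝓝 1))
    {φ : ℝ × ℝ → ℝ} (hφ : Continuous φ) {p : ℝ × ℝ} (hp : p.1 ∈ Ioo (0 : ℝ) 1) :
    Tendsto (fun L => (Ioo (0 : ℝ) 1 ×ˢ univ).indicator φ (discMap (lam L) L p)) atTop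
      (𝓝 (φ p)) := by
  have h1 := tendsto_discMap hlam p
  refine ((hφ.tendsto p).comp h1).congr' ?_
  have hopen : IsOpen (Ioo (0 : ℝ) 1 ×ˢ (univ : Set ℝ)) := isOpen_Ioo.prod isOpen_univ
  filter_upwards [h1.eventually (hopen.mem_nhds ⟨hp, mem_univ _⟩)] with L hL
  exact (indicator_of_mem (show discMap (lam L) L p ∈ Ioo (0 : ℝ) 1 ×ˢ univ from hL) φ).symm

lemma sIntOn_eq_sInt_indicator (s : SignedMeasure (ℝ × ℝ)) {A : Set (ℝ × ℝ)}
    (hA : MeasurableSet A) (f : ℝ × ℝ → ℝ) : sIntOn s A f = sInt s (A.indicator f) := by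
  rw [sIntOn, sInt, integral_indicator hA, integral_indicator hA]

lemma tendsto_setIntegral_discPair_mu {P : MeasPair} (hP : MemMInfty P) {lam : ℝ → ℝ}
    (hlam : Tendsto lam atTop (𝓝 1)) {φ : ℝ × ℝ → ℝ} (hφ : Continuous φ)
    (hφs : HasCompactSupport φ) :
    Tendsto (fun L => ∫ p in Ioo (0 : ℝ) 1 ×ˢ (univ : Set ℝ), φ p ∂(discPair P (lam L) L).mu)
      atTop (𝓝 (∫ p, φ p ∂P.mu)) := by
  have := hP.1
  obtain ⟨C, hC⟩ := exists_norm_le_of_hasCompactSupport hφ hφs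
  have hS : MeasurableSet (Ioo (0 : ℝ) 1 ×ˢ (univ : Set ℝ)) :=
    measurableSet_Ioo.prod MeasurableSet.univ
  have hm := hφ.measurable.indicator hS
  have e : ∀ L, ∫ p in Ioo (0 : ℝ) 1 ×ˢ (univ : Set ℝ), φ p ∂(discPair P (lam L) L).mu =
      lam L ^ 2 *
        ∫ p, (Ioo (0 : ℝ) 1 ×ˢ univ).indicator φ (discMap (lam L) L p) ∂P.mu := fun L => by
    rw [← integral_indicator hS, integral_discPair_mu P _ L hm]
  simp only [e]
  have h1 : Tendsto (fun L => lam L ^ 2) atTop (𝓝 1) := by simpa using hlam.pow 2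
  rw [← one_mul (∫ p, φ p ∂P.mu)]
  refine h1.mul (tendsto_integral_filter_of_dominated_convergence (fun _ => C)
    (Eventually.of_forall fun L => (hm.comp (measurable_discMap _ L)).aestronglyMeasurable)
    (Eventually.of_forall fun L => Eventually.of_forall fun p =>
      (norm_indicator_le_norm_self _ _).trans (hC _)) (integrable_const _) ?_)
  filter_upwards [hP.ae_fst_mem] with p hp using tendsto_indicator_discMap hlam hφ hp

lemma tendsto_sIntOn_discPair_mux {P : MeasPair} (hP : MemMInfty P) {lam : ℝ → ℝ}
    (hlam : Tendsto lam atTop (𝓝 1)) {φ : ℝ × ℝ → ℝ} (hφ : Continuous φ)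
    (hφs : HasCompactSupport φ) :
    Tendsto (fun L => sIntOn (discPair P (lam L) L).mux (Ioo (0 : ℝ) 1 ×ˢ (univ : Set ℝ)) φ)
      atTop (𝓝 (sInt P.mux φ)) := by
  have := hP.1
  obtain ⟨C, hC⟩ := exists_norm_le_of_hasCompactSupport hφ hφs
  have hS : MeasurableSet (Ioo (0 : ℝ) 1 ×ˢ (univ : Set ℝ)) :=
    measurableSet_Ioo.prod MeasurableSet.univ
  have hm := hφ.measurable.indicator hS
  have hb : ∀ p, ‖(Ioo (0 : ℝ) 1 ×ˢ univ).indicator φ p‖ ≤ C := fun p =>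
    (norm_indicator_le_norm_self _ _).trans (hC _)
  have hr : Measurable (P.mux.rnDeriv P.mu) := SignedMeasure.measurable_rnDeriv _ _
  have hi : Integrable (P.mux.rnDeriv P.mu) P.mu := SignedMeasure.integrable_rnDeriv _ _
  have e : ∀ L, sIntOn (discPair P (lam L) L).mux (Ioo (0 : ℝ) 1 ×ˢ (univ : Set ℝ)) φ =
      lam L * ∫ p, (Ioo (0 : ℝ) 1 ×ˢ univ).indicator φ (discMap (lam L) L p) *
        P.mux.rnDeriv P.mu p ∂P.mu := fun L => by
    rw [sIntOn_eq_sInt_indicator _ hS, sInt_discPair_mux P _ L hm hb, ← integral_const_mul]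
    congr 1; ext p; ring
  simp only [e]
  rw [sInt_eq_integral_rnDeriv hP.2.2.2.2.1 hφ.measurable hC,
    ← one_mul (∫ p, φ p * P.mux.rnDeriv P.mu p ∂P.mu)]
  refine hlam.mul (tendsto_integral_filter_of_dominated_convergence
    (fun p => C * ‖P.mux.rnDeriv P.mu p‖)
    (Eventually.of_forall fun L =>
      ((hm.comp (measurable_discMap _ L)).mul hr).aestronglyMeasurable)
    (Eventually.of_forall fun L => Eventually.of_forall fun p => ?_) (hi.norm.const_mul C) ?_)
  · rw [norm_mul]
    exact mul_le_mul_of_nonneg_right (hb _) (norm_nonneg _)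
  · filter_upwards [hP.ae_fst_mem] with p hp
    exact (tendsto_indicator_discMap hlam hφ hp).mul_const _

/-! ### The energy of the discretised pairs -/

lemma Finfty_eq_add {P : MeasPair} (hP : MemMInfty P) :
    Finfty P = (∫⁻ p, ENNReal.ofReal (p.2 ^ 2) ∂P.mu) +
      ∫⁻ p, ENNReal.ofReal (1 / (4 * p.2 ^ 2) * P.mux.rnDeriv P.mu p ^ 2) ∂P.mu := by
  have hres : P.mu.restrict (Ioo 0 1 ×ˢ univ) = P.mu :=
    Measure.restrict_eq_self_of_ae_mem
      (by filter_upwards [hP.ae_fst_mem] with p hp using ⟨hp, mem_univ _⟩)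
  rw [Finfty, hres, ← lintegral_add_left (by fun_prop)]
  refine lintegral_congr fun p => ?_
  rw [ENNReal.ofReal_add (by positivity) (by positivity)]

lemma one_div_sq_Freq_roundAway_le {L : ℝ} (hL : 0 < L) (k : ℝ) :
    1 / (4 * Freq L (roundAway L k) ^ 2) ≤ 1 / (4 * k ^ 2) := by
  rcases eq_or_ne k 0 with rfl | hk
  · rw [Freq_roundAway_zero]
  · have h1 : 0 < k ^ 2 := by positivity
    exact one_div_le_one_div_of_le (by positivity) (by linarith [sq_le_sq_Freq_roundAway hL k])

/-- The discrete form of Jensen's inequality: conditioning on `discMap` does not increase the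
derivative part of the energy. -/
lemma lintegral_rnDeriv_discPair_le {P : MeasPair} (hP : MemMInfty P) {c L : ℝ} (hc : 0 < c)
    (hL : 0 < L)
    (hfin : ∫⁻ p, ENNReal.ofReal (1 / (4 * p.2 ^ 2) * P.mux.rnDeriv P.mu p ^ 2) ∂P.mu ≠ ⊤) :
    ∫⁻ p, ENNReal.ofReal (1 / (4 * p.2 ^ 2) *
        (discPair P c L).mux.rnDeriv (discPair P c L).mu p ^ 2) ∂(discPair P c L).mu ≤
      ∫⁻ p, ENNReal.ofReal (1 / (4 * p.2 ^ 2) * P.mux.rnDeriv P.mu p ^ 2) ∂P.mu := by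
  have := hP.1
  have hmem := discPair_mem hP hc L
  have := hmem.1
  have hHm : Measurable ((discPair P c L).mux.rnDeriv (discPair P c L).mu) :=
    SignedMeasure.measurable_rnDeriv _ _
  have hhm : Measurable (P.mux.rnDeriv P.mu) := SignedMeasure.measurable_rnDeriv _ _
  have hhi : Integrable (P.mux.rnDeriv P.mu) P.mu := SignedMeasure.integrable_rnDeriv _ _
  have hac : ∀ {f : ℝ × ℝ → ℝ}, Measurable f → ∀ {C : ℝ}, (∀ p, ‖f p‖ ≤ C) →
      sInt (discPair P c L).mux f = ∫ p, f p *
        (discPair P c L).mux.rnDeriv (discPair P c L).mu p ∂(discPair P c L).mu :=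
    fun hf _ hC => sInt_eq_integral_rnDeriv hmem.2.2.2.1 hf hC
  set H := (discPair P c L).mux.rnDeriv (discPair P c L).mu
  set h := P.mux.rnDeriv P.mu with hh
  set W : ℝ × ℝ → ℝ := fun p => 1 / (4 * p.2 ^ 2) with hW
  have hWm : Measurable W := by fun_prop
  have hW0 : ∀ p, 0 ≤ W p := fun p => by positivity
  have hT := measurable_discMap c L
  have hri : Integrable (fun p => W p * h p ^ 2) P.mu :=
    ⟨by fun_prop, by
      rw [hasFiniteIntegral_iff_ofReal
        (Eventually.of_forall fun p => mul_nonneg (hW0 p) (sq_nonneg _))]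
      exact hfin.lt_top⟩
  set E : ℕ → Set (ℝ × ℝ) := fun N => {p | |H p| ≤ N} ∩ {p | W p ≤ N} with hE
  have hEm : ∀ N, MeasurableSet (E N) := fun N =>
    (measurableSet_le hHm.abs measurable_const).inter (measurableSet_le hWm measurable_const)
  have hEmono : Monotone E := fun M N hMN p hp =>
    have hMN' : (M : ℝ) ≤ N := by exact_mod_cast hMN
    ⟨le_trans (show |H p| ≤ M from hp.1) hMN', show W p ≤ N from
      le_trans (show W p ≤ M from hp.2) hMN'⟩
  have hEU : ⋃ N, E N = univ := by
    refine eq_univ_of_forall fun p => ?_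
    obtain ⟨N, hN⟩ := exists_nat_ge (max |H p| (W p))
    exact mem_iUnion.mpr ⟨N, (le_max_left _ _).trans hN, (le_max_right _ _).trans hN⟩
  rw [← setLIntegral_univ, ← hEU, setLIntegral_iUnion_of_directed _ hEmono.directed_le]
  refine iSup_le fun N => ?_
  set χ : ℝ × ℝ → ℝ := (E N).indicator fun _ => 1 with hχ
  have hχm : Measurable χ := measurable_const.indicator (hEm N)
  have hχ0 : ∀ p, 0 ≤ χ p := fun p => indicator_nonneg (fun _ _ => zero_le_one) p
  have hχ1 : ∀ p, χ p ≤ 1 := fun p => indicator_le_self' (fun _ _ => zero_le_one) p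
  have hbd : ∀ p, ‖χ p * (W p * H p)‖ ≤ (N : ℝ) * N := by
    intro p
    by_cases hp : p ∈ E N
    · rw [hχ, indicator_of_mem hp, one_mul, norm_mul, Real.norm_of_nonneg (hW0 p)]
      exact mul_le_mul hp.2 hp.1 (norm_nonneg _) (Nat.cast_nonneg _)
    · rw [hχ, indicator_of_notMem hp, zero_mul, norm_zero]; positivity
  have hbd2 : ∀ p, ‖χ p * (W p * H p) * H p‖ ≤ (N : ℝ) * N * N := by
    intro p
    by_cases hp : p ∈ E N
    · rw [norm_mul]
      exact mul_le_mul (hbd p) hp.1 (norm_nonneg _) (by positivity)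
    · rw [hχ, indicator_of_notMem hp, zero_mul, zero_mul, norm_zero]; positivity
  have hgm : Measurable fun p => χ p * (W p * H p) := by fun_prop
  have hgHm : Measurable fun p => χ p * (W p * H p) * H p := by fun_prop
  have hid : c ^ 2 * ∫ p, χ (discMap c L p) * (W (discMap c L p) * H (discMap c L p)) *
        H (discMap c L p) ∂P.mu =
      ∫ p, χ (discMap c L p) * (W (discMap c L p) * H (discMap c L p)) * (c * h p) ∂P.mu := by
    rw [← sInt_discPair_mux P c L hgm hbd, hac hgm hbd, integral_discPair_mu P c L hgHm]
  have hi1 : Integrable (fun p => χ (discMap c L p) *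
      (W (discMap c L p) * H (discMap c L p)) * H (discMap c L p)) P.mu :=
    Integrable.of_bound (hgHm.comp hT).aestronglyMeasurable _
      (Eventually.of_forall fun p => hbd2 _)
  have hi2 : Integrable (fun p => χ (discMap c L p) *
      (W (discMap c L p) * H (discMap c L p)) * (c * h p)) P.mu :=
    (hhi.const_mul c).bdd_mul (hgm.comp hT).aestronglyMeasurable
      (Eventually.of_forall fun p => hbd _)
  have hWT : ∀ p, W (discMap c L p) ≤ W p := fun p => one_div_sq_Freq_roundAway_le hL p.2
  have hle : c ^ 2 * ∫ p, χ (discMap c L p) * (W (discMap c L p) * H (discMap c L p)) *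
      H (discMap c L p) ∂P.mu ≤ ∫ p, W p * h p ^ 2 ∂P.mu := by
    have h2 : ∫ p, 2 * (χ (discMap c L p) * (W (discMap c L p) * H (discMap c L p)) *
        (c * h p)) ∂P.mu ≤ ∫ p, (c ^ 2 * (χ (discMap c L p) *
          (W (discMap c L p) * H (discMap c L p)) * H (discMap c L p)) +
          W p * h p ^ 2) ∂P.mu := by
      refine integral_mono (hi2.const_mul 2) ((hi1.const_mul _).add hri) fun p => ?_
      have a1 := hχ0 (discMap c L p)
      have a2 := hχ1 (discMap c L p)
      have a3 := hW0 (discMap c L p)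
      have a4 := hWT p
      have a5 : χ (discMap c L p) * W (discMap c L p) * h p ^ 2 ≤ W p * h p ^ 2 := by
        refine mul_le_mul_of_nonneg_right ?_ (sq_nonneg _)
        exact (mul_le_of_le_one_left a3 a2).trans a4
      have a6 := mul_nonneg (mul_nonneg a1 a3) (sq_nonneg (c * H (discMap c L p) - h p))
      simp only
      nlinarith [a5, a6]
    rw [integral_const_mul, integral_add (hi1.const_mul _) hri, integral_const_mul, ← hid] at h2
    linarith
  rw [← integral_discPair_mu P c L hgHm] at hle
  calc ∫⁻ p in E N, ENNReal.ofReal (W p * H p ^ 2) ∂(discPair P c L).mu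
      = ∫⁻ p, ENNReal.ofReal (χ p * (W p * H p) * H p) ∂(discPair P c L).mu := by
        rw [← lintegral_indicator (hEm N)]
        refine lintegral_congr fun p => ?_
        by_cases hp : p ∈ E N
        · rw [indicator_of_mem hp, hχ, indicator_of_mem hp]
          congr 1; ring
        · rw [indicator_of_notMem hp, hχ, indicator_of_notMem hp]; simp
    _ = ENNReal.ofReal (∫ p, χ p * (W p * H p) * H p ∂(discPair P c L).mu) := by
        rw [ofReal_integral_eq_lintegral_ofReal]
        · exact Integrable.of_bound hgHm.aestronglyMeasurable _ (Eventually.of_forall hbd2)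
        · refine Eventually.of_forall fun p => ?_
          have := mul_nonneg (mul_nonneg (hχ0 p) (hW0 p)) (sq_nonneg (H p))
          simp only [Pi.zero_apply]
          linarith
    _ ≤ ENNReal.ofReal (∫ p, W p * h p ^ 2 ∂P.mu) := ENNReal.ofReal_le_ofReal hle
    _ = ∫⁻ p, ENNReal.ofReal (W p * h p ^ 2) ∂P.mu :=
        ofReal_integral_eq_lintegral_ofReal hri
          (Eventually.of_forall fun p => mul_nonneg (hW0 p) (sq_nonneg _))

lemma FinftyLam_discPair_le {P : MeasPair} (hP : MemMInfty P) {c L : ℝ} (hc : 0 < c)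
    (hL : 0 < L)
    (hfin : ∫⁻ p, ENNReal.ofReal (1 / (4 * p.2 ^ 2) * P.mux.rnDeriv P.mu p ^ 2) ∂P.mu ≠ ⊤) :
    FinftyLam c (discPair P c L) ≤
      ENNReal.ofReal (c ^ 2) *
        (∫⁻ p, ENNReal.ofReal (Freq L (roundAway L p.2) ^ 2) ∂P.mu) +
      ∫⁻ p, ENNReal.ofReal (1 / (4 * p.2 ^ 2) * P.mux.rnDeriv P.mu p ^ 2) ∂P.mu := by
  have hres : (discPair P c L).mu.restrict (Ioo 0 c ×ˢ univ) = (discPair P c L).mu :=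
    Measure.restrict_eq_self_of_ae_mem
      (by filter_upwards [discPair_mu_ae_fst hP hc L] with p hp using ⟨hp, mem_univ _⟩)
  refine le_trans (le_of_eq ?_) (add_le_add_right (lintegral_rnDeriv_discPair_le hP hc hL hfin) _)
  have e := lintegral_discPair_mu P c L (f := fun p => ENNReal.ofReal (p.2 ^ 2)) (by fun_prop)
  simp only [discMap] at e
  rw [FinftyLam, hres, ← e, ← lintegral_add_left (by fun_prop)]
  refine lintegral_congr fun p => ?_
  rw [ENNReal.ofReal_add (by positivity) (by positivity)]

lemma limsup_FinftyLam_discPair_le {P : MeasPair} (hP : MemMInfty P) (hF : Finfty P ≠ ⊤)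
    {lam : ℝ → ℝ} (hlam1 : ∀ L, 1 < lam L) (hlam : Tendsto lam atTop (𝓝 1)) :
    limsup (fun L => FinftyLam (lam L) (discPair P (lam L) L)) atTop ≤ Finfty P := by
  have := hP.1
  rw [Finfty_eq_add hP] at hF ⊢
  have hk2 : ∫⁻ p, ENNReal.ofReal (p.2 ^ 2) ∂P.mu ≠ ⊤ := fun e => hF (by rw [e, top_add])
  have hd2 : ∫⁻ p, ENNReal.ofReal (1 / (4 * p.2 ^ 2) * P.mux.rnDeriv P.mu p ^ 2) ∂P.mu ≠ ⊤ :=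
    fun e => hF (by rw [e, add_top])
  have hlim : Tendsto (fun L => ∫⁻ p, ENNReal.ofReal (Freq L (roundAway L p.2) ^ 2) ∂P.mu) atTop
      (𝓝 (∫⁻ p, ENNReal.ofReal (p.2 ^ 2) ∂P.mu)) := by
    refine tendsto_lintegral_filter_of_dominated_convergence
      (fun p => 2 * ENNReal.ofReal (p.2 ^ 2) + ENNReal.ofReal (2 * Real.pi ^ 2)) ?_ ?_ ?_ ?_
    · refine Eventually.of_forall fun L => ?_
      have : Measurable fun p : ℝ × ℝ => Freq L (roundAway L p.2) :=
        (measurable_Freq L).comp ((measurable_roundAway L).comp measurable_snd)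
      exact (this.pow_const 2).ennreal_ofReal
    · filter_upwards [eventually_ge_atTop 1] with L hL
      refine Eventually.of_forall fun p => ?_
      have h1 := abs_Freq_roundAway_sub_le (zero_lt_one.trans_le hL) p.2
      have h2 : Real.pi / L ≤ Real.pi := div_le_self Real.pi_pos.le hL
      have h3 := sq_le_sq' (by linarith [neg_abs_le (Freq L (roundAway L p.2) - p.2)])
        ((le_abs_self _).trans (h1.trans h2))
      rw [show (2 : ℝ≥0∞) = ENNReal.ofReal 2 by simp, ← ENNReal.ofReal_mul zero_le_two,
        ← ENNReal.ofReal_add (by positivity) (by positivity)]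
      refine ENNReal.ofReal_le_ofReal ?_
      nlinarith [sq_nonneg (Freq L (roundAway L p.2) - 2 * p.2)]
    · rw [lintegral_add_left (by fun_prop), lintegral_const_mul _ (by fun_prop), lintegral_const]
      exact ENNReal.add_ne_top.mpr ⟨ENNReal.mul_ne_top (by simp) hk2,
        ENNReal.mul_ne_top ENNReal.ofReal_ne_top (measure_ne_top _ _)⟩
    · refine Eventually.of_forall fun p => ?_
      exact (ENNReal.continuous_ofReal.tendsto _).comp ((tendsto_Freq_roundAway p.2).pow 2)
  have hc : Tendsto (fun L => ENNReal.ofReal (lam L ^ 2)) atTop (𝓝 1) := by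
    simpa [Function.comp_def] using (ENNReal.continuous_ofReal.tendsto _).comp (hlam.pow 2)
  have htot := (ENNReal.Tendsto.mul hc (Or.inl one_ne_zero) hlim
    (Or.inr ENNReal.one_ne_top)).add_const (∫⁻ p, ENNReal.ofReal
      (1 / (4 * p.2 ^ 2) * P.mux.rnDeriv P.mu p ^ 2) ∂P.mu)
  rw [one_mul] at htot
  rw [← htot.limsup_eq]
  refine limsup_le_limsup ?_
  filter_upwards [eventually_gt_atTop 0] with L hL
  exact FinftyLam_discPair_le hP (zero_lt_one.trans (hlam1 L)) hL hd2

lemma map_fst_discPair_mu {P : MeasPair} (hP : MemMInfty P) {c : ℝ} (hc : 0 < c) (L : ℝ) :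
    (discPair P c L).mu.map Prod.fst =
      (volume.restrict (Ioo 0 c)).withDensity fun x => ENNReal.ofReal (2 * x) := by
  have := (discPair_mem hP hc L).1
  have hi : IntegrableOn (fun x : ℝ => 2 * x) (Ioo 0 c) :=
    ((by fun_prop : Continuous fun x : ℝ => 2 * x).integrableOn_Icc (a := 0) (b := c)).mono_set
      Ioo_subset_Icc_self
  have hfin : IsFiniteMeasure
      ((volume.restrict (Ioo 0 c)).withDensity fun x => ENNReal.ofReal (2 * x)) :=
    isFiniteMeasure_withDensity_ofReal hi.2
  refine measure_eq_of_test (isOpen_Ioo (a := 0) (b := c)) _ _ ?_ ?_ fun φ hφ => ?_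
  · rw [Measure.map_apply measurable_fst measurableSet_Ioo.compl]
    exact discPair_mu_ae_fst hP hc L
  · exact withDensity_absolutelyContinuous _ _
      (by rw [Measure.restrict_apply measurableSet_Ioo.compl]; simp)
  · rw [integral_map measurable_fst.aemeasurable hφ.1.continuous.aestronglyMeasurable,
      discPair_mu_fst hP hc L hφ,
      integral_withDensity_eq_integral_toReal_smul (by fun_prop)
        (Eventually.of_forall fun _ => ENNReal.ofReal_lt_top)]
    refine setIntegral_congr_fun measurableSet_Ioo fun x hx => ?_
    simp only [smul_eq_mul]
    rw [ENNReal.toReal_ofReal (by linarith [hx.1])]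

/-- All the properties of a discretisation at a fixed scale `L`. -/
lemma exists_slices_discPair {P : MeasPair} (hP : MemMInfty P) {c L : ℝ} (hc : 0 < c)
    (hL : 0 < L) :
    ∃ b b' : ℤ → ℝ → ℝ,
      ((discPair P c L).mu = Measure.sum fun m : ℤ =>
        ((volume.restrict (Ioo (0 : ℝ) c)).withDensity fun x =>
          ENNReal.ofReal (b m x)).map fun x => (x, Freq L m)) ∧
      (∀ m : ℤ, ∀ x ∈ Ioo (0 : ℝ) c, 0 ≤ b m x) ∧
      (∀ m : ℤ, IntegrableOn (b m) (Ioo (0 : ℝ) c) ∧ IntegrableOn (b' m) (Ioo (0 : ℝ) c) ∧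
        HasWeakDerivOn1D (Ioo (0 : ℝ) c) (b m) (b' m)) ∧
      (∀ x ∈ Ioo (0 : ℝ) c, ∑' m : ℤ, b m x = 2 * x) ∧
      MemMInftyLam c (discPair P c L) ∧
      FinftyLam c (discPair P c L) =
        (∑' m : ℤ, ∫⁻ x in Ioo (0 : ℝ) c, ENNReal.ofReal ((Freq L m) ^ 2 * b m x)) +
        (∑' m : ℤ, if m = 0 then 0 else
          ∫⁻ x in Ioo (0 : ℝ) c,
            ENNReal.ofReal (1 / (4 * (Freq L m) ^ 2) * (b' m x) ^ 2 / b m x)) := by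
  have hmem := discPair_mem hP hc L
  have := hmem.1
  have hsnd := discPair_mu_ae_snd P c L
  obtain ⟨b, hb, hb0, hbs, hsl, hsum⟩ :=
    exists_slice_density hL hsnd (map_fst_discPair_mu hP hc L)
  refine ⟨b, fun m x => (discPair P c L).mux.rnDeriv (discPair P c L).mu (x, Freq L m) * b m x,
    ?_, hb0, fun m => ⟨?_, ?_, ?_⟩, hbs, hmem, ?_⟩
  · simpa only [hsl] using hsum
  · simpa using integrableOn_of_slice measurableSet_Ioo (hb m) (hb0 m) (hsl m)
      (g := fun _ => 1) measurable_const (integrable_const _)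
  · exact integrableOn_of_slice measurableSet_Ioo (hb m) (hb0 m) (hsl m)
      (SignedMeasure.measurable_rnDeriv _ _) (SignedMeasure.integrable_rnDeriv _ _)
  · exact hasWeakDerivOn1D_of_slice hL hmem hsnd (hb m) (hb0 m) (hsl m)
  · exact FinftyLam_eq_of_slice hL (discPair_mu_ae_fst hP hc L) hb hb0 hsl hsum

/-- **Discretisation of `μ`.** Let `μ ∈ M_∞` with `F_∞(μ) < ∞` and `λ(L) ↓ 1`. Then there
are `μ^L ∈ M_∞^{λ(L)}` of the discrete form `Σ_{k ∈ πℤ/L} b̄^L(x,k) (L¹⌐(0,λ)) × δ_k` with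
`b̄^L(·,k) ∈ W^{1,1}(0,λ)`, `Σ_k b̄^L(x,k) = 2x`, energy given by the explicit formula,
converging weakly-* (after restriction to `(0,1)×ℝ`) to `(μ, μ_{,x})`, and with
`limsup_L F_∞^λ(μ^L) ≤ F_∞(μ)`. -/
theorem discretisation (P : MeasPair) (hP : MemMInfty P) (hF : Finfty P ≠ ⊤)
    (lam : ℝ → ℝ) (hlam1 : ∀ L, 1 < lam L) (hlam : Tendsto lam atTop (𝓝 1)) :
    ∃ (b b' : ℝ → ℤ → ℝ → ℝ) (Q : ℝ → MeasPair),
      (∀ L > 0,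
        ((Q L).mu = Measure.sum fun m : ℤ =>
          ((volume.restrict (Ioo (0 : ℝ) (lam L))).withDensity fun x =>
            ENNReal.ofReal (b L m x)).map fun x => (x, Freq L m)) ∧
        (∀ m : ℤ, ∀ x ∈ Ioo (0 : ℝ) (lam L), 0 ≤ b L m x) ∧
        (∀ m : ℤ, IntegrableOn (b L m) (Ioo (0 : ℝ) (lam L)) ∧
          IntegrableOn (b' L m) (Ioo (0 : ℝ) (lam L)) ∧
          HasWeakDerivOn1D (Ioo (0 : ℝ) (lam L)) (b L m) (b' L m)) ∧
        (∀ x ∈ Ioo (0 : ℝ) (lam L), ∑' m : ℤ, b L m x = 2 * x) ∧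
        MemMInftyLam (lam L) (Q L) ∧
        FinftyLam (lam L) (Q L) =
          (∑' m : ℤ, ∫⁻ x in Ioo (0 : ℝ) (lam L),
            ENNReal.ofReal ((Freq L m) ^ 2 * b L m x)) +
          (∑' m : ℤ, if m = 0 then 0 else
            ∫⁻ x in Ioo (0 : ℝ) (lam L),
              ENNReal.ofReal (1 / (4 * (Freq L m) ^ 2) * (b' L m x) ^ 2 / b L m x))) ∧
      (∀ φ : ℝ × ℝ → ℝ, Continuous φ → HasCompactSupport φ →
        Tendsto (fun L => ∫ p in Ioo (0 : ℝ) 1 ×ˢ (univ : Set ℝ), φ p ∂(Q L).mu) atTop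
          (𝓝 (∫ p, φ p ∂P.mu)) ∧
        Tendsto (fun L => sIntOn (Q L).mux (Ioo (0 : ℝ) 1 ×ˢ (univ : Set ℝ)) φ) atTop
          (𝓝 (sInt P.mux φ))) ∧
      Filter.limsup (fun L => FinftyLam (lam L) (Q L)) atTop ≤ Finfty P := by
  have h := fun (L : ℝ) (hL : 0 < L) =>
    exists_slices_discPair hP (zero_lt_one.trans (hlam1 L)) hL
  choose! b b' hb using h
  exact ⟨b, b', fun L => discPair P (lam L) L, fun L hL => hb L hL, fun φ hφ hφs =>
    ⟨tendsto_setIntegral_discPair_mu hP hlam hφ hφs,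
      tendsto_sIntOn_discPair_mux hP hlam hφ hφs⟩,
    limsup_FinftyLam_discPair_le hP hF hlam1 hlam⟩
end
end

section
/- (Lower semicontinuity of F_∞) Let (μ_j) ⊂ M_∞ and μ ∈ M_∞ be such that μ_j converges weakly-* to μ. Then μ_{j,x} converges weakly-* to μ_{,x} and liminf_{j→∞} F_∞(μ_j) ≥ F_∞(μ). -/
open MeasureTheory Set Filter Topology
open scoped ENNReal

noncomputable section

open scoped Manifold in
/-- A smooth cutoff function between a compact set and an open neighbourhood of it. -/
lemma exists_isTest2D_cutoff {K U : Set (ℝ × ℝ)} (hK : IsCompact K) (hU : IsOpen U)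
    (hKU : K ⊆ U) :
    ∃ χ : ℝ × ℝ → ℝ, IsTest2D U χ ∧ (∀ p, 0 ≤ χ p) ∧ (∀ p, χ p ≤ 1) ∧ ∀ p ∈ K, χ p = 1 := by
  obtain ⟨L, hL, hKL, hLU⟩ := exists_compact_between hK hU hKU
  obtain ⟨χ, hχ, hr, hsupp, hone⟩ :=
    exists_contMDiff_support_eq_eq_one_iff (n := ⊤) 𝓘(ℝ, ℝ × ℝ) isOpen_interior hK.isClosed hKL
  have hts : tsupport χ ⊆ L :=
    closure_minimal (hsupp.subset.trans interior_subset) hL.isClosed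
  refine ⟨χ, ⟨hχ.contDiff, HasCompactSupport.of_support_subset_isCompact hL
    (hsupp.subset.trans interior_subset), hts.trans hLU⟩, fun p => ?_, fun p => ?_,
    fun p hp => (hone p).1 hp⟩
  · exact (hr (mem_range_self p)).1
  · exact (hr (mem_range_self p)).2

/-- Integration against a signed measure is integration of the Radon–Nikodym derivative. -/
lemma integral_rnDeriv_mul_eq_sInt {s : SignedMeasure (ℝ × ℝ)} {μ : Measure (ℝ × ℝ)}
    [IsFiniteMeasure μ] (h : s.totalVariation ≪ μ) {f : ℝ × ℝ → ℝ} (hf : Continuous f)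
    (hc : HasCompactSupport f) : ∫ p, s.rnDeriv μ p * f p ∂μ = sInt s f := by
  obtain ⟨hp, hn⟩ := (s.totalVariation_absolutelyContinuous_iff μ).1 h
  simp only [SignedMeasure.rnDeriv_def, sub_mul]
  rw [integral_sub, integral_toReal_rnDeriv_mul hp, integral_toReal_rnDeriv_mul hn, sInt]
  · exact (integrable_toReal_rnDeriv_mul_iff hp).2 (hf.integrable_of_hasCompactSupport hc)
  · exact (integrable_toReal_rnDeriv_mul_iff hn).2 (hf.integrable_of_hasCompactSupport hc)

/-- A bounded Borel function vanishing off a compact set is an `L²` limit of test functions. -/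
lemma exists_isTest2D_integral_sq_le {ν : Measure (ℝ × ℝ)} [IsFiniteMeasure ν]
    {g χ : ℝ × ℝ → ℝ} (hg : Measurable g) {G : ℝ} (hG : ∀ p, |g p| ≤ G)
    {U : Set (ℝ × ℝ)} (hχ : IsTest2D U χ) (h0 : ∀ p, 0 ≤ χ p) (h1 : ∀ p, χ p ≤ 1)
    (hχg : ∀ p, χ p * g p = g p) {ε : ℝ} (hε : 0 < ε) :
    ∃ ψ : ℝ × ℝ → ℝ, IsTest2D U ψ ∧ tsupport ψ ⊆ tsupport χ ∧
      ∫ p, (g p - ψ p) ^ 2 ∂ν ≤ ε ^ 2 := by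
  have hgL : MemLp g 2 ν := MemLp.of_bound hg.aestronglyMeasurable G (.of_forall hG)
  obtain ⟨φ, hφc, hφ, hφε⟩ := hgL.exist_eLpNorm_sub_le (by simp) (by norm_num) hε
  have hφL : MemLp φ 2 ν := hφ.continuous.memLp_of_hasCompactSupport hφc
  have hts : tsupport (fun p => χ p * φ p) ⊆ tsupport χ := tsupport_mul_subset_left
  refine ⟨fun p => χ p * φ p, ⟨hχ.1.mul hφ, hχ.2.1.mul_right, hts.trans hχ.2.2⟩, hts, ?_⟩
  have hsub : MemLp (g - φ) 2 ν := hgL.sub hφL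
  have hint : Integrable (fun p => (g p - φ p) ^ 2) ν := hsub.integrable_sq
  calc ∫ p, (g p - χ p * φ p) ^ 2 ∂ν ≤ ∫ p, (g p - φ p) ^ 2 ∂ν := by
        refine integral_mono_of_nonneg (.of_forall fun p => sq_nonneg _) hint
          (.of_forall fun p => ?_)
        have : g p - χ p * φ p = χ p * (g p - φ p) := by rw [mul_sub, hχg]
        simp only [this, mul_pow]
        exact mul_le_of_le_one_left (sq_nonneg _) (pow_le_one₀ (h0 p) (h1 p))
    _ ≤ ε ^ 2 := by
        rw [hsub.eLpNorm_eq_integral_rpow_norm (by simp) (by simp),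
          ENNReal.ofReal_le_ofReal_iff hε.le] at hφε
        have h := pow_le_pow_left₀ (by positivity) hφε 2
        rw [← Real.rpow_natCast, ← Real.rpow_mul (by positivity)] at h
        simpa using h

/-- The part of the open strip `(0,1) × ℝ` away from the line `k = 0`. -/
def PuncturedStrip : Set (ℝ × ℝ) := Ioo (0 : ℝ) 1 ×ˢ {0}ᶜ

/-- The dual pairing: its supremum over admissible `χ` and `ψ` is `F_∞`. -/
def dualPairing (μ : Measure (ℝ × ℝ)) (r χ ψ : ℝ × ℝ → ℝ) : ℝ :=
  ∫ p, (χ p * p.2 ^ 2 + r p * ψ p - (p.2 * ψ p) ^ 2) ∂μ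

lemma isOpen_puncturedStrip : IsOpen PuncturedStrip :=
  isOpen_Ioo.prod isOpen_compl_singleton

lemma IsTest2D.mono {A B : Set (ℝ × ℝ)} (h : A ⊆ B) {φ : ℝ × ℝ → ℝ} (hφ : IsTest2D A φ) :
    IsTest2D B φ := ⟨hφ.1, hφ.2.1, hφ.2.2.trans h⟩

lemma IsTest2D.eq_zero {A : Set (ℝ × ℝ)} {φ : ℝ × ℝ → ℝ} (hφ : IsTest2D A φ) {p : ℝ × ℝ}
    (hp : p ∉ A) : φ p = 0 :=
  image_eq_zero_of_notMem_tsupport fun h => hp (hφ.2.2 h)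

lemma puncturedStrip_subset_strip : PuncturedStrip ⊆ Strip := fun p hp =>
  ⟨⟨by linarith [hp.1.1], hp.1.2⟩, mem_univ _⟩

lemma integrable_signedMeasure_rnDeriv_mul (s : SignedMeasure (ℝ × ℝ)) (μ : Measure (ℝ × ℝ))
    {A : Set (ℝ × ℝ)} {ψ : ℝ × ℝ → ℝ} (hψ : IsTest2D A ψ) :
    Integrable (fun p => s.rnDeriv μ p * ψ p) μ := by
  obtain ⟨C, hC⟩ := hψ.2.1.exists_bound_of_continuous hψ.1.continuous
  exact (s.integrable_rnDeriv μ).mul_bdd (c := C) hψ.1.continuous.aestronglyMeasurable (.of_forall hC)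

lemma IsTest2D.integrable_mul_sq {A : Set (ℝ × ℝ)} {χ : ℝ × ℝ → ℝ} (hχ : IsTest2D A χ)
    (μ : Measure (ℝ × ℝ)) [IsFiniteMeasure μ] : Integrable (fun p => χ p * p.2 ^ 2) μ :=
  (hχ.1.continuous.mul (by fun_prop)).integrable_of_hasCompactSupport hχ.2.1.mul_right

lemma hasCompactSupport_snd_mul_sq {ψ : ℝ × ℝ → ℝ} (hψ : HasCompactSupport ψ) :
    HasCompactSupport (fun p : ℝ × ℝ => (p.2 * ψ p) ^ 2) :=
  hψ.mono fun p hp h => hp (by simp [h])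

lemma IsTest2D.integrable_snd_mul_sq {A : Set (ℝ × ℝ)} {ψ : ℝ × ℝ → ℝ} (hψ : IsTest2D A ψ)
    (μ : Measure (ℝ × ℝ)) [IsFiniteMeasure μ] : Integrable (fun p => (p.2 * ψ p) ^ 2) μ :=
  ((continuous_snd.mul hψ.1.continuous).pow 2).integrable_of_hasCompactSupport
    (hasCompactSupport_snd_mul_sq hψ.2.1)

lemma integrable_dualPairing (s : SignedMeasure (ℝ × ℝ)) (μ : Measure (ℝ × ℝ))
    [IsFiniteMeasure μ] {A : Set (ℝ × ℝ)} {χ ψ : ℝ × ℝ → ℝ} (hχ : IsTest2D A χ)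
    (hψ : IsTest2D A ψ) :
    Integrable (fun p => χ p * p.2 ^ 2 + s.rnDeriv μ p * ψ p - (p.2 * ψ p) ^ 2) μ :=
  ((hχ.integrable_mul_sq μ).add (integrable_signedMeasure_rnDeriv_mul s μ hψ)).sub
    (hψ.integrable_snd_mul_sq μ)

lemma MemMInfty.dualPairing_eq {P : MeasPair} (hP : MemMInfty P) {χ ψ : ℝ × ℝ → ℝ}
    (hχ : IsTest2D PuncturedStrip χ) (hψ : IsTest2D PuncturedStrip ψ) :
    dualPairing P.mu (P.mux.rnDeriv P.mu) χ ψ =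
      ∫ p, χ p * p.2 ^ 2 ∂P.mu - ∫ p, dX ψ p ∂P.mu - ∫ p, (p.2 * ψ p) ^ 2 ∂P.mu := by
  obtain ⟨hfin, -, -, hder, hac, -⟩ := hP
  have hr := integrable_signedMeasure_rnDeriv_mul P.mux P.mu hψ
  have hsum : Integrable (fun p => χ p * p.2 ^ 2 + P.mux.rnDeriv P.mu p * ψ p) P.mu :=
    (hχ.integrable_mul_sq _).add hr
  rw [dualPairing, integral_sub hsum (hψ.integrable_snd_mul_sq _),
    integral_add (hχ.integrable_mul_sq _) hr,
    integral_rnDeriv_mul_eq_sInt hac hψ.1.continuous hψ.2.1,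
    hder ψ (hψ.mono puncturedStrip_subset_strip)]
  ring

lemma mul_sub_sq_le (k r a : ℝ) (hk : k ≠ 0) :
    r * a - (k * a) ^ 2 ≤ 1 / (4 * k ^ 2) * r ^ 2 := by
  have : 1 / (4 * k ^ 2) * r ^ 2 - (r * a - (k * a) ^ 2) = (r / (2 * k) - k * a) ^ 2 := by
    field_simp
    ring
  nlinarith [sq_nonneg (r / (2 * k) - k * a)]

lemma MemMInfty.ofReal_dualPairing_le {P : MeasPair} (hP : MemMInfty P) {χ ψ : ℝ × ℝ → ℝ}
    (hχ : IsTest2D PuncturedStrip χ) (hψ : IsTest2D PuncturedStrip ψ) (h1 : ∀ p, χ p ≤ 1) :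
    ENNReal.ofReal (dualPairing P.mu (P.mux.rnDeriv P.mu) χ ψ) ≤ Finfty P := by
  have := hP.1
  have hint := integrable_dualPairing P.mux P.mu hχ hψ
  have hS : MeasurableSet (Ioo (0 : ℝ) 1 ×ˢ (univ : Set ℝ)) := measurableSet_Ioo.prod .univ
  calc ENNReal.ofReal (dualPairing P.mu (P.mux.rnDeriv P.mu) χ ψ)
      ≤ ENNReal.ofReal
          (∫ p, max (χ p * p.2 ^ 2 + P.mux.rnDeriv P.mu p * ψ p - (p.2 * ψ p) ^ 2) 0 ∂P.mu) :=
        ENNReal.ofReal_le_ofReal (integral_mono hint hint.pos_part fun p => le_max_left _ _)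
    _ = ∫⁻ p, ENNReal.ofReal
          (max (χ p * p.2 ^ 2 + P.mux.rnDeriv P.mu p * ψ p - (p.2 * ψ p) ^ 2) 0) ∂P.mu :=
        ofReal_integral_eq_lintegral_ofReal hint.pos_part (.of_forall fun p => le_max_right _ _)
    _ ≤ Finfty P := by
        rw [Finfty, ← lintegral_indicator hS]
        refine lintegral_mono fun p => ?_
        by_cases hp : p ∈ PuncturedStrip
        · have hpS : p ∈ Ioo (0 : ℝ) 1 ×ˢ (univ : Set ℝ) := ⟨hp.1, mem_univ _⟩
          rw [indicator_of_mem hpS]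
          refine ENNReal.ofReal_le_ofReal (max_le ?_ (by positivity))
          have := mul_sub_sq_le p.2 (P.mux.rnDeriv P.mu p) (ψ p) hp.2
          nlinarith [h1 p, sq_nonneg p.2]
        · simp [hχ.eq_zero hp, hψ.eq_zero hp]

lemma continuous_dX {A : Set (ℝ × ℝ)} {φ : ℝ × ℝ → ℝ} (hφ : IsTest2D A φ) :
    Continuous (dX φ) :=
  (hφ.1.continuous_fderiv (by simp)).clm_apply continuous_const

lemma hasCompactSupport_dX {φ : ℝ × ℝ → ℝ} (hφ : HasCompactSupport φ) :
    HasCompactSupport (dX φ) :=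
  hφ.fderiv_apply ℝ _

/-- The dual pairing with the limit is bounded by the lower limit of the energies. -/
lemma ofReal_dualPairing_le_liminf {P : ℕ → MeasPair} (hP : ∀ j, MemMInfty (P j))
    {Q : MeasPair} (hQ : MemMInfty Q)
    (hconv : ∀ φ : ℝ × ℝ → ℝ, Continuous φ → HasCompactSupport φ →
      Tendsto (fun j => ∫ p, φ p ∂(P j).mu) atTop (𝓝 (∫ p, φ p ∂Q.mu)))
    {χ ψ : ℝ × ℝ → ℝ} (hχ : IsTest2D PuncturedStrip χ) (hψ : IsTest2D PuncturedStrip ψ)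
    (h1 : ∀ p, χ p ≤ 1) :
    ENNReal.ofReal (dualPairing Q.mu (Q.mux.rnDeriv Q.mu) χ ψ) ≤
      liminf (fun j => Finfty (P j)) atTop := by
  have hlim : Tendsto
      (fun j => ENNReal.ofReal (dualPairing (P j).mu ((P j).mux.rnDeriv (P j).mu) χ ψ)) atTop
      (𝓝 (ENNReal.ofReal (dualPairing Q.mu (Q.mux.rnDeriv Q.mu) χ ψ))) := by
    refine ENNReal.tendsto_ofReal ?_
    simp only [(hP _).dualPairing_eq hχ hψ, hQ.dualPairing_eq hχ hψ]
    refine ((hconv _ ?_ ?_).sub (hconv _ ?_ ?_)).sub (hconv _ ?_ ?_)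
    · exact hχ.1.continuous.mul (by fun_prop)
    · exact hχ.2.1.mul_right
    · exact continuous_dX hψ
    · exact hasCompactSupport_dX hψ.2.1
    · exact (continuous_snd.mul hψ.1.continuous).pow 2
    · exact hasCompactSupport_snd_mul_sq hψ.2.1
  rw [← hlim.liminf_eq]
  exact liminf_le_liminf (.of_forall fun j => (hP j).ofReal_dualPairing_le hχ hψ h1)

lemma abs_le_add_sq_div (t : ℝ) {ε : ℝ} (hε : 0 < ε) : |t| ≤ ε + t ^ 2 / ε := by
  rw [← sq_abs, ← sub_nonneg]
  have : ε + |t| ^ 2 / ε - |t| = ((ε - |t|) ^ 2 + ε * |t|) / ε := by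
    field_simp
    ring
  rw [this]
  positivity

lemma quadratic_sub_le {k r a b B G ε : ℝ} (hB : k ^ 2 ≤ B) (ha : |a| ≤ G) (hε : 0 < ε) :
    (r * a - k ^ 2 * a ^ 2) - (r * b - (k * b) ^ 2) ≤
      (1 + |r|) * ((1 + 2 * B * G) * (ε + (a - b) ^ 2 / ε) + B * (a - b) ^ 2) := by
  have hB0 : 0 ≤ B := (sq_nonneg k).trans hB
  have hG0 : 0 ≤ G := (abs_nonneg a).trans ha
  have h1 : r * (a - b) ≤ |r| * |a - b| := (le_abs_self _).trans (abs_mul _ _).le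
  have h2 : -(k ^ 2 * a * (a - b)) ≤ B * G * |a - b| := by
    refine (neg_le_abs _).trans ?_
    rw [abs_mul, abs_mul, abs_of_nonneg (sq_nonneg k)]
    gcongr
  have h3 : k ^ 2 * (a - b) ^ 2 ≤ B * (a - b) ^ 2 := by gcongr
  calc (r * a - k ^ 2 * a ^ 2) - (r * b - (k * b) ^ 2)
      = r * (a - b) + 2 * -(k ^ 2 * a * (a - b)) + k ^ 2 * (a - b) ^ 2 := by ring
    _ ≤ |r| * |a - b| + 2 * (B * G * |a - b|) + B * (a - b) ^ 2 := by linarith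
    _ ≤ (1 + |r|) * ((1 + 2 * B * G) * |a - b| + B * (a - b) ^ 2) := by
        have e1 : 0 ≤ |r| * (2 * B * G * |a - b|) := by positivity
        have e2 : 0 ≤ |r| * (B * (a - b) ^ 2) := by positivity
        nlinarith [abs_nonneg (a - b)]
    _ ≤ _ := by
        gcongr
        exact abs_le_add_sq_div _ hε

/-- Bounded competitors vanishing off a compact set may replace smooth ones in the dual
pairing, up to an error controlled by their `L²` distance. -/
lemma integral_le_of_dualPairing_le {s : SignedMeasure (ℝ × ℝ)} {μ : Measure (ℝ × ℝ)}
    [IsFiniteMeasure μ] {χ g : ℝ × ℝ → ℝ} (hχ : IsTest2D PuncturedStrip χ)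
    (h0 : ∀ p, 0 ≤ χ p) (h1 : ∀ p, χ p ≤ 1) (hg : Measurable g) {G : ℝ}
    (hG : ∀ p, |g p| ≤ G) (hχg : ∀ p, χ p * g p = g p) {c : ℝ}
    (hc : ∀ ψ, IsTest2D PuncturedStrip ψ → dualPairing μ (s.rnDeriv μ) χ ψ ≤ c)
    (hint : Integrable
      (fun p => χ p * p.2 ^ 2 + (s.rnDeriv μ p * g p - χ p * p.2 ^ 2 * g p ^ 2)) μ) :
    ∫ p, (χ p * p.2 ^ 2 + (s.rnDeriv μ p * g p - χ p * p.2 ^ 2 * g p ^ 2)) ∂μ ≤ c := by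
  set r := s.rnDeriv μ with hr
  have hrm : Measurable r := s.measurable_rnDeriv μ
  have hri : Integrable r μ := s.integrable_rnDeriv μ
  have hwi : Integrable (fun p => 1 + |r p|) μ := (integrable_const 1).add hri.abs
  set ν := μ.withDensity fun p => ENNReal.ofReal (1 + |r p|) with hν
  have : IsFiniteMeasure ν := isFiniteMeasure_withDensity_ofReal hwi.2
  obtain ⟨B, hB⟩ := hχ.2.1.isCompact.exists_bound_of_continuousOn
    (f := fun p : ℝ × ℝ => p.2 ^ 2) (by fun_prop)
  have hB' : ∀ p ∈ tsupport χ, p.2 ^ 2 ≤ |B| := fun p hp =>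
    (le_abs_self _).trans ((hB p hp).trans (le_abs_self B))
  have hG0 : 0 ≤ G := (abs_nonneg _).trans (hG 0)
  set D := 1 + 2 * |B| * G with hD
  have hD0 : 0 ≤ D := by positivity
  have key : ∀ ε > 0, ∫ p, (χ p * p.2 ^ 2 + (r p * g p - χ p * p.2 ^ 2 * g p ^ 2)) ∂μ ≤
      c + (D * ε * ν.real univ + (D * ε + |B| * ε ^ 2)) := by
    intro ε hε
    obtain ⟨ψ, hψ, hψχ, hψε⟩ := exists_isTest2D_integral_sq_le (ν := ν) hg hG hχ h0 h1 hχg hε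
    obtain ⟨C, hC⟩ := hψ.2.1.exists_bound_of_continuous hψ.1.continuous
    have htm : Measurable fun p => g p - ψ p := hg.sub hψ.1.continuous.measurable
    have htb : ∀ p, (g p - ψ p) ^ 2 ≤ (G + C) ^ 2 := fun p => by
      rw [← sq_abs (g p - ψ p)]
      exact pow_le_pow_left₀ (abs_nonneg _) ((abs_sub _ _).trans (add_le_add (hG p) (hC p))) 2
    have hti : Integrable (fun p => (g p - ψ p) ^ 2) ν :=
      Integrable.of_bound (htm.pow_const 2).aestronglyMeasurable ((G + C) ^ 2)
        (.of_forall fun p => by rw [Real.norm_of_nonneg (sq_nonneg _)]; exact htb p)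
    have hFν : ∀ F : ℝ × ℝ → ℝ, ∫ p, F p ∂ν = ∫ p, (1 + |r p|) * F p ∂μ := fun F => by
      rw [hν, integral_withDensity_eq_integral_toReal_smul (by fun_prop)
        (.of_forall fun p => ENNReal.ofReal_lt_top)]
      refine integral_congr_ae (.of_forall fun p => ?_)
      simp only [smul_eq_mul]
      rw [ENNReal.toReal_ofReal (by positivity)]
    have hFi : Integrable (fun p => (1 + |r p|) *
        (D * (ε + (g p - ψ p) ^ 2 / ε) + |B| * (g p - ψ p) ^ 2)) μ := by
      refine hwi.mul_bdd (c := D * (ε + (G + C) ^ 2 / ε) + |B| * (G + C) ^ 2)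
        (by fun_prop) (.of_forall fun p => ?_)
      rw [Real.norm_of_nonneg (by positivity)]
      have := htb p
      gcongr
    have hle : ∫ p, (χ p * p.2 ^ 2 + (r p * g p - χ p * p.2 ^ 2 * g p ^ 2)) ∂μ -
        dualPairing μ r χ ψ ≤
        ∫ p, (1 + |r p|) * (D * (ε + (g p - ψ p) ^ 2 / ε) + |B| * (g p - ψ p) ^ 2) ∂μ := by
      rw [dualPairing, ← integral_sub hint (integrable_dualPairing s μ hχ hψ)]
      refine integral_mono (hint.sub (integrable_dualPairing s μ hχ hψ)) hFi fun p => ?_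
      by_cases hp : p ∈ tsupport χ
      · have hq := quadratic_sub_le (r := r p) (b := ψ p) (hB' p hp) (hG p) hε
        have e : χ p * p.2 ^ 2 * g p ^ 2 = p.2 ^ 2 * g p ^ 2 := by
          linear_combination p.2 ^ 2 * g p * hχg p
        simp only [e]
        linarith
      · have hχ0 : χ p = 0 := image_eq_zero_of_notMem_tsupport hp
        have hψ0 : ψ p = 0 := image_eq_zero_of_notMem_tsupport fun h => hp (hψχ h)
        have hg0 : g p = 0 := by rw [← hχg p, hχ0, zero_mul]
        simp only [hχ0, hψ0, hg0]
        ring_nf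
        positivity
    have hsi : Integrable (fun p => ε + (g p - ψ p) ^ 2 / ε) ν :=
      (integrable_const ε).add (hti.div_const ε)
    rw [← hFν, integral_add (hsi.const_mul D) (hti.const_mul _), integral_const_mul, integral_const_mul,
      integral_add (integrable_const ε) (hti.div_const ε), integral_const, integral_div,
      smul_eq_mul] at hle
    have e1 : (∫ p, (g p - ψ p) ^ 2 ∂ν) / ε ≤ ε := by
      rw [div_le_iff₀ hε]; linarith
    have e2 := mul_le_mul_of_nonneg_left e1 hD0
    have e3 := mul_le_mul_of_nonneg_left hψε (abs_nonneg B)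
    have e4 := hc ψ hψ
    nlinarith
  have hlim : Tendsto (fun ε : ℝ => c + (D * ε * ν.real univ + (D * ε + |B| * ε ^ 2)))
      (𝓝[>] 0) (𝓝 c) := by
    have : Continuous fun ε : ℝ => c + (D * ε * ν.real univ + (D * ε + |B| * ε ^ 2)) := by
      fun_prop
    simpa using (this.tendsto 0).mono_left nhdsWithin_le_nhds
  exact ge_of_tendsto hlim (eventually_mem_nhdsWithin.mono key)

/-- The dual pairings control the energy on compactly contained sets where the optimal
competitor is bounded. -/
lemma setLIntegral_le_of_dualPairing_le {s : SignedMeasure (ℝ × ℝ)} {μ : Measure (ℝ × ℝ)}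
    [IsFiniteMeasure μ] {A K : Set (ℝ × ℝ)} (hA : MeasurableSet A) (hAK : A ⊆ K)
    (hK : IsCompact K) (hKU : K ⊆ PuncturedStrip) {G : ℝ} (hG0 : 0 ≤ G)
    (hG : ∀ p ∈ A, |s.rnDeriv μ p / (2 * p.2 ^ 2)| ≤ G) {c : ℝ≥0∞}
    (hc : ∀ χ ψ, IsTest2D PuncturedStrip χ → IsTest2D PuncturedStrip ψ → (∀ p, χ p ≤ 1) →
      ENNReal.ofReal (dualPairing μ (s.rnDeriv μ) χ ψ) ≤ c) :
    ∫⁻ p in A, ENNReal.ofReal (p.2 ^ 2 + 1 / (4 * p.2 ^ 2) * (s.rnDeriv μ p) ^ 2) ∂μ ≤ c := by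
  induction c with
  | top => exact le_top
  | coe c =>
  obtain ⟨χ, hχ, h0, h1, hχK⟩ := exists_isTest2D_cutoff hK isOpen_puncturedStrip hKU
  have hrm : Measurable (s.rnDeriv μ) := s.measurable_rnDeriv μ
  have hgm : Measurable (A.indicator fun p => s.rnDeriv μ p / (2 * p.2 ^ 2)) :=
    Measurable.indicator (by fun_prop) hA
  set g := A.indicator fun p => s.rnDeriv μ p / (2 * p.2 ^ 2) with hg
  have hgA : ∀ p ∈ A, g p = s.rnDeriv μ p / (2 * p.2 ^ 2) := fun p hp => indicator_of_mem hp _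
  have hgA' : ∀ p ∉ A, g p = 0 := fun p hp => indicator_of_notMem hp _
  have hgG : ∀ p, |g p| ≤ G := fun p => by
    by_cases hp : p ∈ A
    · rw [hgA p hp]; exact hG p hp
    · simpa [hgA' p hp] using hG0
  have hχg : ∀ p, χ p * g p = g p := fun p => by
    by_cases hp : p ∈ A
    · rw [hχK p (hAK hp), one_mul]
    · rw [hgA' p hp, mul_zero]
  have hχi := hχ.integrable_mul_sq μ
  have hint : Integrable
      (fun p => χ p * p.2 ^ 2 + (s.rnDeriv μ p * g p - χ p * p.2 ^ 2 * g p ^ 2)) μ := by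
    refine hχi.add (((s.integrable_rnDeriv μ).mul_bdd (c := G) hgm.aestronglyMeasurable
      (.of_forall hgG)).sub (hχi.mul_bdd (c := G ^ 2) (hgm.pow_const 2).aestronglyMeasurable
      (.of_forall fun p => ?_)))
    rw [norm_pow]
    exact pow_le_pow_left₀ (norm_nonneg _) (hgG p) 2
  have hle := integral_le_of_dualPairing_le hχ h0 h1 hgm hgG hχg (c := c)
    (fun ψ hψ => by
      have := hc χ ψ hχ hψ h1
      rwa [← ENNReal.ofReal_coe_nnreal, ENNReal.ofReal_le_ofReal_iff c.coe_nonneg] at this) hint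
  have hin : ∀ p ∈ A, χ p * p.2 ^ 2 + (s.rnDeriv μ p * g p - χ p * p.2 ^ 2 * g p ^ 2) =
      p.2 ^ 2 + 1 / (4 * p.2 ^ 2) * (s.rnDeriv μ p) ^ 2 := fun p hp => by
    have hk : p.2 ≠ 0 := (hKU (hAK hp)).2
    rw [hχK p (hAK hp), hgA p hp]
    field_simp
    ring
  have hnn : ∀ p, 0 ≤ χ p * p.2 ^ 2 + (s.rnDeriv μ p * g p - χ p * p.2 ^ 2 * g p ^ 2) :=
    fun p => by
      by_cases hp : p ∈ A
      · rw [hin p hp]; positivity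
      · have := h0 p
        rw [hgA' p hp]
        ring_nf
        positivity
  calc ∫⁻ p in A, ENNReal.ofReal (p.2 ^ 2 + 1 / (4 * p.2 ^ 2) * (s.rnDeriv μ p) ^ 2) ∂μ
      = ∫⁻ p in A, ENNReal.ofReal
          (χ p * p.2 ^ 2 + (s.rnDeriv μ p * g p - χ p * p.2 ^ 2 * g p ^ 2)) ∂μ :=
        setLIntegral_congr_fun hA fun p hp => by rw [hin p hp]
    _ ≤ ∫⁻ p, ENNReal.ofReal
          (χ p * p.2 ^ 2 + (s.rnDeriv μ p * g p - χ p * p.2 ^ 2 * g p ^ 2)) ∂μ :=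
        setLIntegral_le_lintegral _ _
    _ = ENNReal.ofReal
          (∫ p, (χ p * p.2 ^ 2 + (s.rnDeriv μ p * g p - χ p * p.2 ^ 2 * g p ^ 2)) ∂μ) :=
        (ofReal_integral_eq_lintegral_ofReal hint (.of_forall hnn)).symm
    _ ≤ c := by
        rw [← ENNReal.ofReal_coe_nnreal]
        exact ENNReal.ofReal_le_ofReal hle

/-- A compact exhaustion of the punctured strip. -/
def compactExhaust (n : ℕ) : Set (ℝ × ℝ) :=
  Icc (1 / ((n : ℝ) + 1)) (1 - 1 / ((n : ℝ) + 1)) ×ˢ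
    (Icc (-(n : ℝ)) n ∩ {k | 1 / ((n : ℝ) + 1) ≤ |k|})

lemma isCompact_compactExhaust (n : ℕ) : IsCompact (compactExhaust n) :=
  isCompact_Icc.prod (isCompact_Icc.inter_right (isClosed_le continuous_const continuous_abs))

lemma compactExhaust_subset (n : ℕ) : compactExhaust n ⊆ PuncturedStrip := by
  have hn : (0 : ℝ) < 1 / ((n : ℝ) + 1) := by positivity
  rintro p ⟨⟨h1, h2⟩, -, h3⟩
  exact ⟨⟨by linarith, by linarith⟩, abs_pos.1 (hn.trans_le h3)⟩

lemma compactExhaust_mono : Monotone compactExhaust := by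
  rintro m n hmn p ⟨⟨h1, h2⟩, ⟨h3, h4⟩, h5⟩
  have h : 1 / ((n : ℝ) + 1) ≤ 1 / ((m : ℝ) + 1) := by gcongr
  have hmn' : (m : ℝ) ≤ n := by exact_mod_cast hmn
  exact ⟨⟨by linarith, by linarith⟩, ⟨by linarith, by linarith⟩, h.trans h5⟩

lemma eventually_mem_compactExhaust {p : ℝ × ℝ} (hp : p ∈ PuncturedStrip) :
    ∀ᶠ n in atTop, p ∈ compactExhaust n := by
  have ht : Tendsto (fun n : ℕ => 1 / ((n : ℝ) + 1)) atTop (𝓝 0) :=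
    tendsto_one_div_add_atTop_nhds_zero_nat
  filter_upwards [ht.eventually_le_const hp.1.1,
    ht.eventually_le_const (sub_pos.2 hp.1.2), ht.eventually_le_const (abs_pos.2 hp.2),
    tendsto_natCast_atTop_atTop.eventually_ge_atTop |p.2|] with n h1 h2 h3 h4
  exact ⟨⟨h1, by linarith⟩, abs_le.1 h4, h3⟩

lemma Finfty_le_of_dualPairing_le {P : MeasPair} [IsFiniteMeasure P.mu] {c : ℝ≥0∞}
    (hc : ∀ χ ψ, IsTest2D PuncturedStrip χ → IsTest2D PuncturedStrip ψ → (∀ p, χ p ≤ 1) →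
      ENNReal.ofReal (dualPairing P.mu (P.mux.rnDeriv P.mu) χ ψ) ≤ c) :
    Finfty P ≤ c := by
  set r := P.mux.rnDeriv P.mu with hr
  have hrm : Measurable r := P.mux.measurable_rnDeriv P.mu
  set A : ℕ → Set (ℝ × ℝ) := fun n => compactExhaust n ∩ {p | |r p / (2 * p.2 ^ 2)| ≤ (n : ℝ)}
  have hAm : ∀ n, MeasurableSet (A n) := fun n =>
    (isCompact_compactExhaust n).measurableSet.inter
      (measurableSet_le (by fun_prop) measurable_const)
  have hmono : Monotone A := fun m n hmn => inter_subset_inter (compactExhaust_mono hmn) <| by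
    simp only [ofPred_subset_ofPred]
    exact fun p hp => hp.trans (Nat.cast_le.2 hmn)
  have hsub : Finfty P ≤ ∫⁻ p in ⋃ n, A n,
      ENNReal.ofReal (p.2 ^ 2 + 1 / (4 * p.2 ^ 2) * (r p) ^ 2) ∂P.mu := by
    rw [Finfty, ← lintegral_indicator (measurableSet_Ioo.prod .univ),
      ← lintegral_indicator (.iUnion hAm)]
    refine lintegral_mono fun p => ?_
    by_cases hp : p ∈ PuncturedStrip
    · obtain ⟨n, hn, hn'⟩ := ((eventually_mem_compactExhaust hp).and
        (tendsto_natCast_atTop_atTop.eventually_ge_atTop |r p / (2 * p.2 ^ 2)|)).exists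
      have hpA : p ∈ ⋃ n, A n := mem_iUnion.2 ⟨n, hn, hn'⟩
      rw [indicator_of_mem hpA]
      exact indicator_le_self _ _ _
    · by_cases hk : p.2 = 0
      · simp [indicator_apply, hk]
      · have hpS : p ∉ Ioo (0 : ℝ) 1 ×ˢ (univ : Set ℝ) := fun h => hp ⟨h.1, hk⟩
        rw [indicator_of_notMem hpS]
        exact zero_le
  refine hsub.trans ?_
  rw [setLIntegral_iUnion_of_directed _ (s := A) hmono.directed_le]
  exact iSup_le fun n => setLIntegral_le_of_dualPairing_le (hAm n) inter_subset_left
    (isCompact_compactExhaust n) (compactExhaust_subset n) n.cast_nonneg (fun p hp => hp.2) hc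

/-- **Lower semicontinuity of `F_∞`.** If `μ_j ∈ M_∞` converge weakly-* to `μ ∈ M_∞`,
then `μ_{j,x} ⇀* μ_{,x}` and `liminf_j F_∞(μ_j) ≥ F_∞(μ)`. -/
theorem lower_semicontinuity
    (P : ℕ → MeasPair) (hP : ∀ j, MemMInfty (P j))
    (Q : MeasPair) (hQ : MemMInfty Q)
    (hconv : ∀ φ : ℝ × ℝ → ℝ, Continuous φ → HasCompactSupport φ →
      Tendsto (fun j => ∫ p, φ p ∂(P j).mu) atTop (𝓝 (∫ p, φ p ∂Q.mu))) :
    (∀ φ : ℝ × ℝ → ℝ, IsTest φ →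
      Tendsto (fun j => sInt (P j).mux φ) atTop (𝓝 (sInt Q.mux φ))) ∧
    Finfty Q ≤ Filter.liminf (fun j => Finfty (P j)) atTop := by
  refine ⟨fun φ hφ => ?_, ?_⟩
  · simp only [(hP _).2.2.2.1 φ hφ, hQ.2.2.2.1 φ hφ]
    exact (hconv _ (continuous_dX hφ) (hasCompactSupport_dX hφ.2.1)).neg
  · have := hQ.1
    exact Finfty_le_of_dualPairing_le fun χ ψ hχ hψ h1 =>
      ofReal_dualPairing_le_liminf hP hQ hconv hχ hψ h1
end
end

section
/- (Disintegration of μ ∈ M_∞ in the k-variable) Let μ ∈ M_∞ with F_∞(μ) < +∞. Then there exists a ((π₂)♯μ)-measurable map k ↦ g_k such that ((π₂)♯μ, (g_k)_{k∈ℝ}) is a disintegration of μ in the k-variable; moreover for (π₂)♯μ-a.e. k ∈ ℝ one has g_k ∈ W^{1,1}(0,1) with ġ_k(x) = (dμ_{,x}/dμ)(x,k) g_k(x) for a.e. x ∈ (0,1). -/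
open MeasureTheory Set Filter Topology
open scoped ENNReal

noncomputable section

lemma integral_mul_integral_indicator_Iic {ν τ : Measure ℝ} [SFinite ν] [SFinite τ]
    {r g : ℝ → ℝ} (hr : Integrable r ν) (hg : Integrable g τ) :
    ∫ x, g x * ∫ t, (Iic x).indicator r t ∂ν ∂τ =
      ∫ t, r t * ∫ x, (Ici t).indicator g x ∂τ ∂ν := by
  have hS : MeasurableSet {p : ℝ × ℝ | p.2 ≤ p.1} := measurableSet_le measurable_snd measurable_fst
  have hswap_int : Integrable ({p : ℝ × ℝ | p.2 ≤ p.1}.indicator fun p => g p.1 * r p.2) (τ.prod ν) :=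
    (hg.mul_prod hr).indicator hS
  have h1 : ∀ x t, g x * (Iic x).indicator r t =
      {p : ℝ × ℝ | p.2 ≤ p.1}.indicator (fun p => g p.1 * r p.2) (x, t) := by
    intro x t
    by_cases h : t ≤ x <;> simp [indicator, h]
  have h2 : ∀ t x, r t * (Ici t).indicator g x =
      {p : ℝ × ℝ | p.2 ≤ p.1}.indicator (fun p => g p.1 * r p.2) (x, t) := by
    intro t x
    by_cases h : t ≤ x <;> simp [indicator, h, mul_comm]
  simp_rw [← integral_const_mul, h1, h2]
  exact integral_integral_swap hswap_int

lemma measureReal_eq_setIntegral_of_contDiff {E : Type*} [NormedAddCommGroup E]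
    [NormedSpace ℝ E] [FiniteDimensional ℝ E] [MeasurableSpace E] [BorelSpace E]
    {m n : Measure E} [IsFiniteMeasure m] [IsFiniteMeasure n] {H : E → ℝ} (hH : Integrable H n)
    {U : Set E} (hU : IsOpen U)
    (h : ∀ g : E → ℝ, ContDiff ℝ (⊤ : ℕ∞) g → HasCompactSupport g → tsupport g ⊆ U →
      ∫ x, g x ∂m = ∫ x, g x * H x ∂n)
    {s : Set E} (hs : MeasurableSet s) (hsU : s ⊆ U) : m.real s = ∫ x in s, H x ∂n := by
  have hm : m ≪ m + n := Measure.absolutelyContinuous_of_le (Measure.le_add_right le_rfl)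
  have hn : n ≪ m + n := Measure.absolutelyContinuous_of_le (Measure.le_add_left le_rfl)
  have hbH : Integrable (fun x => (n.rnDeriv (m + n) x).toReal • H x) (m + n) :=
    (integrable_rnDeriv_smul_iff hn).2 hH
  have ha : Integrable (fun x => (m.rnDeriv (m + n) x).toReal) (m + n) :=
    Measure.integrable_toReal_rnDeriv
  have key := hU.ae_eq_zero_of_integral_contDiff_smul_eq_zero
    ((ha.sub hbH).locallyIntegrable.locallyIntegrableOn U) (fun g hg hgc hgU => by
      obtain ⟨C, hC⟩ := hg.continuous.bounded_above_of_compact_support hgc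
      have hgm : Integrable g m := hg.continuous.integrable_of_hasCompactSupport hgc
      have hgn : Integrable (fun x => g x * H x) n :=
        hH.bdd_mul hg.continuous.aestronglyMeasurable (ae_of_all _ hC)
      have e1 := integral_rnDeriv_smul hm (f := g)
      have e2 := integral_rnDeriv_smul hn (f := fun x => g x * H x)
      have i1 := (integrable_rnDeriv_smul_iff hm).2 hgm
      have i2 := (integrable_rnDeriv_smul_iff hn).2 hgn
      have : ∀ x, g x • ((fun x => (m.rnDeriv (m + n) x).toReal) -
          fun x => (n.rnDeriv (m + n) x).toReal • H x) x =
          (m.rnDeriv (m + n) x).toReal • g x - (n.rnDeriv (m + n) x).toReal • (g x * H x) := by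
        intro x
        simp only [Pi.sub_apply, smul_eq_mul]
        ring
      simp_rw [this]
      rw [integral_sub i1 i2, e1, e2, h g hg hgc hgU, sub_self])
  have e1 := setIntegral_rnDeriv_smul hm (f := fun _ => (1 : ℝ)) hs
  have e2 := setIntegral_rnDeriv_smul hn (f := H) hs
  rw [← e2]
  simp only [smul_eq_mul, mul_one, integral_const, MeasurableSet.univ, measureReal_restrict_apply,
    univ_inter] at e1
  rw [← e1]
  refine setIntegral_congr_ae hs ?_
  filter_upwards [key] with x hx hxs
  have := hx (hsU hxs)
  simpa [sub_eq_zero] using this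

lemma exists_primitive_test {g : ℝ × ℝ → ℝ} (hg : ContDiff ℝ (⊤ : ℕ∞) g)
    (hgc : HasCompactSupport g) (hgU : tsupport g ⊆ univ ×ˢ Ioo (0 : ℝ) 1) :
    ∃ Ψ : ℝ × ℝ → ℝ, ContDiff ℝ (⊤ : ℕ∞) Ψ ∧ HasCompactSupport Ψ ∧
      tsupport Ψ ⊆ univ ×ˢ Ioo (-1 : ℝ) 1 ∧
      ∀ k, ∀ t ∈ Ioo (0 : ℝ) 1,
        Ψ (k, t) = ∫ x in Ioo (0 : ℝ) 1, (Ici t).indicator (fun x => g (k, x)) x ∧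
        fderiv ℝ Ψ (k, t) (0, 1) = - g (k, t) := by
  have hgcont := hg.continuous
  obtain ⟨b, hb1, hb⟩ : ∃ b : ℝ, b < 1 ∧ ∀ p ∈ tsupport g, p.2 ≤ b := by
    have hK : IsCompact (insert 0 (Prod.snd '' tsupport g)) :=
      (hgc.isCompact.image continuous_snd).insert 0
    obtain ⟨b, hbK, hb⟩ := hK.exists_isGreatest (insert_nonempty _ _)
    refine ⟨b, ?_, fun p hp => hb (mem_insert_of_mem _ ⟨p, hp, rfl⟩)⟩
    rcases hbK with rfl | ⟨p, hp, rfl⟩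
    · exact one_pos
    · exact (hgU hp).2.2
  have hg0 : ∀ k x, x ∉ Ioo (0 : ℝ) 1 → g (k, x) = 0 := fun k x hx =>
    image_eq_zero_of_notMem_tsupport fun h => hx (hgU h).2
  have hgb : ∀ k x, b < x → g (k, x) = 0 := fun k x hx =>
    image_eq_zero_of_notMem_tsupport fun h => (hb _ h).not_gt hx
  have hgk : ∀ k x, k ∉ Prod.fst '' tsupport g → g (k, x) = 0 := fun k x hx =>
    image_eq_zero_of_notMem_tsupport fun h => hx ⟨_, h, rfl⟩
  have hsl : ∀ k, Continuous fun x => g (k, x) := fun k => by fun_prop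
  have hslc : ∀ k, HasCompactSupport fun x => g (k, x) := fun k =>
    HasCompactSupport.intro isCompact_Icc (K := Icc (0 : ℝ) 1)
      fun x hx => hg0 k x fun h => hx (Ioo_subset_Icc_self h)
  have hsli : ∀ k, Integrable fun x => g (k, x) := fun k =>
    (hsl k).integrable_of_hasCompactSupport (hslc k)
  set Φ : ℝ × ℝ → ℝ := fun p => ∫ x in Ici p.2, g (p.1, x) with hΦ
  have hΦs : ContDiff ℝ (⊤ : ℕ∞) Φ := by
    have := contDiffOn_convolution_right_with_param (μ := volume) (n := ⊤)
      (f := (Iic (0 : ℝ)).indicator fun _ => (1 : ℝ)) (ContinuousLinearMap.lsmul ℝ ℝ)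
      (g := fun k x => g (k, x)) isOpen_univ (isCompact_Icc (a := (0 : ℝ)) (b := 1))
      (fun k x _ hx => hg0 k x fun h => hx (Ioo_subset_Icc_self h))
      ((locallyIntegrable_const (1 : ℝ)).indicator measurableSet_Iic) hg.contDiffOn
    rw [univ_prod_univ, contDiffOn_univ] at this
    convert this using 1
    funext p
    rw [convolution_lsmul_swap]
    simp only [hΦ]
    rw [← integral_indicator measurableSet_Ici]
    refine integral_congr_ae (ae_of_all _ fun x => ?_)
    by_cases h : p.2 ≤ x <;> simp [indicator, h]
  have hΦd : ∀ k t, fderiv ℝ Φ (k, t) (0, 1) = - g (k, t) := by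
    intro k t
    have h1 : HasDerivAt (fun s => Φ (k, s)) (fderiv ℝ Φ (k, t) (0, 1)) t := by
      have := (hΦs.differentiable (by simp) (k, t)).hasFDerivAt
      exact this.comp_hasDerivAt t ((hasDerivAt_const t k).prodMk (hasDerivAt_id t))
    have h2 : (fun s => Φ (k, s)) = fun s => Φ (k, 0) - ∫ x in (0 : ℝ)..s, g (k, x) := by
      funext s
      simp only [hΦ, integral_Ici_eq_integral_Ioi]
      rw [eq_sub_iff_add_eq, add_comm]
      exact intervalIntegral.integral_interval_add_Ioi (hsli k).integrableOn (hsli k).integrableOn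
    have h3 : HasDerivAt (fun s => Φ (k, s)) (- g (k, t)) t := by
      rw [h2]
      exact ((hsl k).integral_hasStrictDerivAt 0 t).hasDerivAt.const_sub _
    exact h1.unique h3
  have hχ : ContDiff ℝ (⊤ : ℕ∞) fun p : ℝ × ℝ => Real.smoothTransition (2 * p.2 + 1) :=
    Real.smoothTransition.contDiff.comp (by fun_prop)
  have hsupp : tsupport (fun p : ℝ × ℝ => Real.smoothTransition (2 * p.2 + 1) * Φ p) ⊆
      (Prod.fst '' tsupport g) ×ˢ Icc (-(1 / 2) : ℝ) b := by
    refine closure_minimal (fun p hp => ?_)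
      ((hgc.isCompact.image continuous_fst).isClosed.prod isClosed_Icc)
    rw [Function.mem_support] at hp
    refine ⟨?_, ?_, ?_⟩
    · by_contra hk
      refine hp ?_
      simp [hΦ, hgk p.1 _ hk]
    · by_contra! hk
      refine hp ?_
      rw [Real.smoothTransition.zero_of_nonpos (by linarith), zero_mul]
    · by_contra! hk
      refine hp ?_
      have : Φ p = 0 := setIntegral_eq_zero_of_forall_eq_zero fun x hx => hgb p.1 x (hk.trans_le hx)
      rw [this, mul_zero]
  refine ⟨fun p => Real.smoothTransition (2 * p.2 + 1) * Φ p, hχ.mul hΦs, ?_, ?_, ?_⟩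
  · exact ((hgc.isCompact.image continuous_fst).prod isCompact_Icc).of_isClosed_subset
      (isClosed_tsupport _) hsupp
  · exact hsupp.trans (prod_mono (subset_univ _)
      fun x hx => ⟨by linarith [hx.1], hx.2.trans_lt hb1⟩)
  · intro k t ht
    have hev : ∀ p : ℝ × ℝ, 0 < p.2 → Real.smoothTransition (2 * p.2 + 1) * Φ p = Φ p :=
      fun p hp => by rw [Real.smoothTransition.one_of_one_le (by linarith), one_mul]
    constructor
    · beta_reduce
      rw [hev (k, t) ht.1, ← integral_indicator measurableSet_Ioo, hΦ]
      simp only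
      rw [← integral_indicator measurableSet_Ici]
      refine integral_congr_ae (ae_of_all _ fun x => ?_)
      by_cases hx : x ∈ Ioo (0 : ℝ) 1
      · simp [indicator_of_mem hx]
      · simp [indicator, hg0 k x hx]
    · rw [← hΦd]
      congr 1
      refine Filter.EventuallyEq.fderiv_eq ?_
      have : ∀ᶠ p : ℝ × ℝ in 𝓝 (k, t), 0 < p.2 :=
        (isOpen_lt continuous_const continuous_snd).mem_nhds ht.1
      filter_upwards [this] with p hp using hev p hp

lemma integral_indicator_Ici_deriv {φ : ℝ → ℝ} (hφ : IsTest1D (Ioo (0 : ℝ) 1) φ) {t : ℝ}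
    (ht : t ∈ Ioo (0 : ℝ) 1) :
    ∫ x in Ioo (0 : ℝ) 1, (Ici t).indicator (deriv φ) x = - φ t := by
  have h1 : φ 1 = 0 := image_eq_zero_of_notMem_tsupport fun h => lt_irrefl _ (hφ.2.2 h).2
  have hset : Ioo (0 : ℝ) 1 ∩ Ici t = Ico t 1 := by
    ext x
    simp only [mem_inter_iff, mem_Ioo, mem_Ici, mem_Ico]
    exact ⟨fun h => ⟨h.2, h.1.2⟩, fun h => ⟨⟨ht.1.trans_le h.1, h.2⟩, h.1⟩⟩
  rw [setIntegral_indicator measurableSet_Ici, hset, integral_Ico_eq_integral_Ioc,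
    ← intervalIntegral.integral_of_le ht.2.le,
    intervalIntegral.integral_deriv_eq_sub
      (fun x _ => hφ.1.differentiable (by simp) x)
      ((hφ.1.continuous_deriv (by simp)).intervalIntegrable _ _), h1, zero_sub]

lemma sInt_eq_integral_rnDeriv_s18 {s : SignedMeasure (ℝ × ℝ)} {μ : Measure (ℝ × ℝ)}
    [IsFiniteMeasure μ] (hs : s.totalVariation ≪ μ) {f : ℝ × ℝ → ℝ} (hf : Continuous f)
    (hfc : HasCompactSupport f) : sInt s f = ∫ p, s.rnDeriv μ p * f p ∂μ := by
  have hpos : s.toJordanDecomposition.posPart ≪ μ :=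
    (Measure.absolutelyContinuous_of_le (Measure.le_add_right le_rfl)).trans hs
  have hneg : s.toJordanDecomposition.negPart ≪ μ :=
    (Measure.absolutelyContinuous_of_le (Measure.le_add_left le_rfl)).trans hs
  have i1 := (integrable_rnDeriv_smul_iff hpos).2 (hf.integrable_of_hasCompactSupport hfc)
  have i2 := (integrable_rnDeriv_smul_iff hneg).2 (hf.integrable_of_hasCompactSupport hfc)
  rw [sInt, ← integral_rnDeriv_smul hpos, ← integral_rnDeriv_smul hneg, ← integral_sub i1 i2]
  refine integral_congr_ae (ae_of_all _ fun p => ?_)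
  simp only [SignedMeasure.rnDeriv_def, smul_eq_mul]
  ring

/-- The fibrewise primitive of `r` with respect to the conditional measures of `M`. -/
def condPrimitive (M : Measure (ℝ × ℝ)) [IsFiniteMeasure M] (r : ℝ × ℝ → ℝ) (p : ℝ × ℝ) : ℝ :=
  ∫ t, (Iic p.2).indicator (fun t => r (p.1, t)) t ∂(M.condKernel p.1)

section

variable {M : Measure (ℝ × ℝ)} [IsFiniteMeasure M] {r : ℝ × ℝ → ℝ}

lemma stronglyMeasurable_condPrimitive (hr : Measurable r) :
    StronglyMeasurable (condPrimitive M r) := by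
  have hS : MeasurableSet {q : (ℝ × ℝ) × ℝ | q.2 ≤ q.1.2} :=
    measurableSet_le measurable_snd (measurable_snd.comp measurable_fst)
  have hf : StronglyMeasurable ({q : (ℝ × ℝ) × ℝ | q.2 ≤ q.1.2}.indicator
      fun q => r (q.1.1, q.2)) :=
    ((hr.comp (by fun_prop)).indicator hS).stronglyMeasurable
  exact hf.integral_kernel_prod_right' (κ := M.condKernel.comap Prod.fst measurable_fst)

lemma integrable_condPrimitive (hr : Measurable r) (hri : Integrable r M) :
    Integrable (condPrimitive M r) (M.fst.prod (volume.restrict (Ioo (0 : ℝ) 1))) := by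
  have hb : Integrable (fun k => ∫ t, ‖r (k, t)‖ ∂M.condKernel k) M.fst :=
    hri.integral_norm_condKernel
  refine (hb.comp_fst (volume.restrict (Ioo (0 : ℝ) 1))).mono'
    (stronglyMeasurable_condPrimitive hr).aestronglyMeasurable ?_
  have h1 : ∀ᵐ p ∂(M.fst.prod (volume.restrict (Ioo (0 : ℝ) 1))),
      Integrable (fun t => r (p.1, t)) (M.condKernel p.1) :=
    Measure.quasiMeasurePreserving_fst.ae hri.condKernel_ae
  filter_upwards [h1] with p hp
  refine (norm_integral_le_integral_norm _).trans ?_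
  refine integral_mono_of_nonneg (ae_of_all _ fun t => norm_nonneg _) hp.norm
    (ae_of_all _ fun t => ?_)
  exact norm_indicator_le_norm_self _ _

lemma measureReal_eq_setIntegral_condPrimitive (hr : Measurable r) (hri : Integrable r M)
    (hM : M (univ ×ˢ Ioo (0 : ℝ) 1)ᶜ = 0)
    (hibp : ∀ Ψ : ℝ × ℝ → ℝ, ContDiff ℝ (⊤ : ℕ∞) Ψ → HasCompactSupport Ψ →
      tsupport Ψ ⊆ univ ×ˢ Ioo (-1 : ℝ) 1 →
      ∫ p, r p * Ψ p ∂M = - ∫ p, fderiv ℝ Ψ p (0, 1) ∂M)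
    {s : Set (ℝ × ℝ)} (hs : MeasurableSet s) (hsU : s ⊆ univ ×ˢ Ioo (0 : ℝ) 1) :
    M.real s = ∫ p in s, condPrimitive M r p ∂(M.fst.prod (volume.restrict (Ioo (0 : ℝ) 1))) := by
  have hH := integrable_condPrimitive hr hri
  refine measureReal_eq_setIntegral_of_contDiff hH (isOpen_univ.prod isOpen_Ioo) ?_ hs hsU
  intro g hg hgc hgU
  obtain ⟨Ψ, hΨ, hΨc, hΨU, hΨg⟩ := exists_primitive_test hg hgc hgU
  have hMae : ∀ᵐ p ∂M, p ∈ (univ : Set ℝ) ×ˢ Ioo (0 : ℝ) 1 := hM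
  obtain ⟨C, hC⟩ := hg.continuous.bounded_above_of_compact_support hgc
  obtain ⟨D, hD⟩ := hΨ.continuous.bounded_above_of_compact_support hΨc
  have hgH : Integrable (fun p => g p * condPrimitive M r p)
      (M.fst.prod (volume.restrict (Ioo (0 : ℝ) 1))) :=
    hH.bdd_mul hg.continuous.aestronglyMeasurable (ae_of_all _ hC)
  have hrΨ : Integrable (fun p => r p * Ψ p) M :=
    hri.mul_bdd hΨ.continuous.aestronglyMeasurable (ae_of_all _ hD)
  have hcond : ∀ᵐ k ∂M.fst, ∀ᵐ t ∂M.condKernel k, t ∈ Ioo (0 : ℝ) 1 := by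
    have := hMae
    rw [← M.disintegrate M.condKernel] at this
    filter_upwards [Measure.ae_ae_of_ae_compProd this] with k hk
    filter_upwards [hk] with t ht using ht.2
  rw [integral_prod _ hgH]
  calc ∫ p, g p ∂M = - ∫ p, fderiv ℝ Ψ p (0, 1) ∂M := by
        rw [← integral_neg]
        refine integral_congr_ae ?_
        filter_upwards [hMae] with p hp
        rw [(hΨg p.1 p.2 hp.2).2, neg_neg]
    _ = ∫ p, r p * Ψ p ∂M := (hibp Ψ hΨ hΨc hΨU).symm
    _ = ∫ k, ∫ t, r (k, t) * Ψ (k, t) ∂M.condKernel k ∂M.fst :=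
        (Measure.integral_condKernel hrΨ).symm
    _ = _ := by
        refine integral_congr_ae ?_
        filter_upwards [hri.condKernel_ae, hcond] with k hk hkt
        have hgk : Integrable (fun x => g (k, x)) (volume.restrict (Ioo (0 : ℝ) 1)) := by
          refine Integrable.of_bound (C := C) ?_ (ae_of_all _ fun x => hC _)
          exact (hg.continuous.comp (by fun_prop)).aestronglyMeasurable
        simp only [condPrimitive]
        rw [integral_mul_integral_indicator_Iic hk hgk]
        refine integral_congr_ae ?_
        filter_upwards [hkt] with t ht
        rw [(hΨg k t ht).1]

/-- Almost every conditional measure of `M` is absolutely continuous on `(0,1)`, with density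
a.e. equal to the fibrewise primitive of `r`. -/
lemma exists_density_condKernel_eq_condPrimitive (hr : Measurable r) (hri : Integrable r M)
    (hM : M (univ ×ˢ Ioo (0 : ℝ) 1)ᶜ = 0)
    (hibp : ∀ Ψ : ℝ × ℝ → ℝ, ContDiff ℝ (⊤ : ℕ∞) Ψ → HasCompactSupport Ψ →
      tsupport Ψ ⊆ univ ×ˢ Ioo (-1 : ℝ) 1 →
      ∫ p, r p * Ψ p ∂M = - ∫ p, fderiv ℝ Ψ p (0, 1) ∂M) :
    ∃ g : ℝ → ℝ → ℝ≥0∞, Measurable (Function.uncurry g) ∧ ∀ᵐ k ∂M.fst,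
      (∀ᵐ x ∂(volume.restrict (Ioo (0 : ℝ) 1)), g k x < ⊤) ∧
      M.condKernel k = (volume.restrict (Ioo (0 : ℝ) 1)).withDensity (g k) ∧
      ∀ᵐ x ∂(volume.restrict (Ioo (0 : ℝ) 1)), (g k x).toReal = condPrimitive M r (k, x) := by
  set V : Measure ℝ := volume.restrict (Ioo (0 : ℝ) 1) with hV
  set U : Set (ℝ × ℝ) := univ ×ˢ Ioo (0 : ℝ) 1 with hU
  have hUm : MeasurableSet U := MeasurableSet.univ.prod measurableSet_Ioo
  have hreal : ∀ s, MeasurableSet s →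
      M.real s = ∫ p in s, condPrimitive M r p ∂(M.fst.prod V) := by
    intro s hs
    have h1 : M.real s = M.real (s ∩ U) := by
      rw [measureReal_def, measureReal_def, measure_inter_conull hM]
    have hVU : (M.fst.prod V) Uᶜ = 0 := by
      have : Uᶜ = univ ×ˢ (Ioo (0 : ℝ) 1)ᶜ := by ext; simp [hU]
      rw [this, Measure.prod_prod, hV, Measure.restrict_apply measurableSet_Ioo.compl]
      simp
    rw [h1, measureReal_eq_setIntegral_condPrimitive hr hri hM hibp (hs.inter hUm)
      inter_subset_right]
    refine setIntegral_congr_set ?_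
    exact inter_ae_eq_left_of_ae_eq_univ (by simpa [ae_eq_univ] using hVU)
  have hac : M ≪ M.fst.prod V := by
    refine Measure.AbsolutelyContinuous.mk fun s hs h0 => ?_
    have := hreal s hs
    rw [Measure.restrict_eq_zero.2 h0, integral_zero_measure] at this
    exact (measureReal_eq_zero_iff (by finiteness)).1 this
  have hker : ∀ᵐ k ∂M.fst, M.condKernel k ≪ ProbabilityTheory.Kernel.const ℝ V k := by
    rw [← Measure.absolutelyContinuous_compProd_right_iff, M.disintegrate, Measure.compProd_const]
    exact hac
  set η : ProbabilityTheory.Kernel ℝ ℝ := ProbabilityTheory.Kernel.const ℝ V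
  set G : ℝ × ℝ → ℝ≥0∞ := fun p => M.condKernel.rnDeriv η p.1 p.2 with hG
  have hGm : Measurable G := ProbabilityTheory.Kernel.measurable_rnDeriv _ _
  have hdens : ∀ᵐ k ∂M.fst, M.condKernel k = V.withDensity fun x => G (k, x) := by
    filter_upwards [hker] with k hk
    have := ProbabilityTheory.Kernel.withDensity_rnDeriv_eq hk
    rw [ProbabilityTheory.Kernel.withDensity_apply _
      (ProbabilityTheory.Kernel.measurable_rnDeriv _ _)] at this
    exact this.symm
  have hlt : ∀ k, ∀ᵐ x ∂V, G (k, x) < ⊤ := fun k =>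
    ProbabilityTheory.Kernel.rnDeriv_lt_top M.condKernel η (a := k)
  have hMG : M = (M.fst.prod V).withDensity G := by
    ext s hs
    rw [withDensity_apply _ hs, ← lintegral_indicator hs,
      lintegral_prod _ (hGm.indicator hs).aemeasurable]
    conv_lhs => rw [← M.disintegrate M.condKernel]
    rw [Measure.compProd_apply hs]
    refine lintegral_congr_ae ?_
    filter_upwards [hdens] with k hk
    rw [hk, withDensity_apply _ (measurable_prodMk_left hs),
      ← lintegral_indicator (measurable_prodMk_left hs)]
    rfl
  have hGi : ∫⁻ p, G p ∂(M.fst.prod V) ≠ ⊤ := by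
    have : M univ = _ := congrArg (fun m : Measure (ℝ × ℝ) => m univ) hMG
    rw [withDensity_apply _ MeasurableSet.univ, Measure.restrict_univ] at this
    rw [← this]
    finiteness
  have hGeq : (fun p => (G p).toReal) =ᵐ[M.fst.prod V] condPrimitive M r := by
    refine (integrable_toReal_of_lintegral_ne_top hGm.aemeasurable hGi).ae_eq_of_forall_setIntegral_eq
      _ _ (integrable_condPrimitive hr hri) fun s hs _ => ?_
    rw [← hreal s hs, integral_toReal hGm.aemeasurable.restrict
      (ae_restrict_of_ae (ae_lt_top hGm hGi)), ← withDensity_apply _ hs, ← hMG, measureReal_def]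
  refine ⟨fun k x => G (k, x), hGm, ?_⟩
  filter_upwards [hdens, Measure.ae_ae_of_ae_prod hGeq] with k hk hkG
  exact ⟨hlt k, hk, hkG⟩

end

/-- **Disintegration of `μ ∈ M_∞` in the `k`-variable.** If `F_∞(μ) < ∞`, then `μ` admits
a disintegration `((π₂)♯μ, (g_k))` in the `k`-variable with, for `(π₂)♯μ`-a.e. `k`,
`g_k ∈ W^{1,1}(0,1)` and `ġ_k = (dμ_{,x}/dμ)(·,k) g_k` a.e. on `(0,1)`. -/
theorem disintegration_k
    (P : MeasPair) (hP : MemMInfty P) (hF : Finfty P ≠ ⊤) :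
    ∃ g g' : ℝ → ℝ → ℝ,
      IsDisintegrationK (Ioo (0 : ℝ) 1) P.mu (P.mu.map Prod.snd) g ∧
      ∀ᵐ k ∂(P.mu.map Prod.snd),
        IntegrableOn (g k) (Ioo (0 : ℝ) 1) ∧ IntegrableOn (g' k) (Ioo (0 : ℝ) 1) ∧
        HasWeakDerivOn1D (Ioo (0 : ℝ) 1) (g k) (g' k) ∧
        (∀ᵐ x ∂(volume.restrict (Ioo (0 : ℝ) 1)),
          g' k x = P.mux.rnDeriv P.mu (x, k) * g k x) := by
  obtain ⟨hfin, hstrip, hneg, hweak, hac, -⟩ := hP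
  set M : Measure (ℝ × ℝ) := P.mu.map Prod.swap with hMdef
  set V : Measure ℝ := volume.restrict (Ioo (0 : ℝ) 1) with hV
  set r : ℝ × ℝ → ℝ := fun p => P.mux.rnDeriv P.mu p.swap with hrdef
  have hswap : MeasurableEmbedding (Prod.swap : ℝ × ℝ → ℝ × ℝ) :=
    MeasurableEquiv.prodComm.measurableEmbedding
  have hfst : M.fst = P.mu.map Prod.snd := Measure.fst_map_swap
  have hr : Measurable r := (SignedMeasure.measurable_rnDeriv _ _).comp measurable_swap
  have hri : Integrable r M := by
    rw [hMdef, hswap.integrable_map_iff]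
    exact SignedMeasure.integrable_rnDeriv P.mux P.mu
  have hmu : P.mu (Ioo (0 : ℝ) 1 ×ˢ univ)ᶜ = 0 := by
    refine measure_mono_null (fun p hp => ?_) (measure_union_null hstrip hneg)
    by_cases h : p ∈ Strip
    · refine Or.inr ⟨⟨h.1.1, ?_⟩, mem_univ _⟩
      by_contra! h0
      exact hp ⟨⟨h0, h.1.2⟩, mem_univ _⟩
    · exact Or.inl h
  have hM : M (univ ×ˢ Ioo (0 : ℝ) 1)ᶜ = 0 := by
    rw [hMdef, hswap.map_apply, preimage_compl, preimage_swap_prod]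
    exact hmu
  have hibp : ∀ Ψ : ℝ × ℝ → ℝ, ContDiff ℝ (⊤ : ℕ∞) Ψ → HasCompactSupport Ψ →
      tsupport Ψ ⊆ univ ×ˢ Ioo (-1 : ℝ) 1 →
      ∫ p, r p * Ψ p ∂M = - ∫ p, fderiv ℝ Ψ p (0, 1) ∂M := by
    intro Ψ hΨ hΨc hΨU
    have hcont : ContDiff ℝ (⊤ : ℕ∞) fun p : ℝ × ℝ => Ψ p.swap :=
      hΨ.comp (contDiff_snd.prodMk contDiff_fst)
    have hcs : HasCompactSupport fun p : ℝ × ℝ => Ψ p.swap :=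
      hΨc.comp_homeomorph (Homeomorph.prodComm ℝ ℝ)
    have htest : IsTest fun p : ℝ × ℝ => Ψ p.swap := by
      refine ⟨hcont, hcs, fun p hp => ?_⟩
      have : p.swap ∈ tsupport Ψ :=
        tsupport_comp_subset_preimage Ψ continuous_swap hp
      exact ⟨(hΨU this).2, mem_univ _⟩
    have hd : ∀ p, dX (fun p : ℝ × ℝ => Ψ p.swap) p = fderiv ℝ Ψ p.swap (0, 1) := by
      intro p
      have h1 := (hΨ.differentiable (by simp) p.swap).hasFDerivAt
      have h2 : HasFDerivAt (Prod.swap : ℝ × ℝ → ℝ × ℝ)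
          (ContinuousLinearEquiv.prodComm ℝ ℝ ℝ : ℝ × ℝ →L[ℝ] ℝ × ℝ) p :=
        (ContinuousLinearEquiv.prodComm ℝ ℝ ℝ).hasFDerivAt
      have h3 : HasFDerivAt (fun p : ℝ × ℝ => Ψ p.swap) _ p := h1.comp p h2
      rw [dX, h3.fderiv]
      rfl
    have := hweak _ htest
    rw [sInt_eq_integral_rnDeriv_s18 hac hcont.continuous hcs] at this
    simp_rw [hd] at this
    rw [hMdef, hswap.integral_map, hswap.integral_map]
    exact this
  obtain ⟨g, hgm, hg⟩ := exists_density_condKernel_eq_condPrimitive hr hri hM hibp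
  have hgk : ∀ k, Measurable (g k) := fun k => hgm.comp measurable_prodMk_left
  have hone : ∀ᵐ k ∂M.fst, ∫ x in Ioo (0 : ℝ) 1, (g k x).toReal = 1 := by
    filter_upwards [hg] with k ⟨hlt, hk, _⟩
    rw [integral_toReal (hgk k).aemeasurable hlt, ← setLIntegral_univ,
      ← withDensity_apply _ MeasurableSet.univ, ← hk, measure_univ, ENNReal.toReal_one]
  rw [← hfst]
  refine ⟨fun k x => (g k x).toReal, fun k x => P.mux.rnDeriv P.mu (x, k) * (g k x).toReal,
    ⟨hgm.ennreal_toReal, hone, fun f hf => ?_⟩, ?_⟩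
  · have hfM : Integrable (fun p => f p.swap) M := by
      rw [hMdef, hswap.integrable_map_iff]
      exact hf
    have h1 : ∫ p in Ioo (0 : ℝ) 1 ×ˢ (univ : Set ℝ), f p ∂P.mu = ∫ p, f p.swap ∂M := by
      rw [hMdef, hswap.integral_map, setIntegral_congr_set (ae_eq_univ.2 hmu), setIntegral_univ]
      rfl
    rw [h1, ← Measure.integral_condKernel hfM]
    refine integral_congr_ae ?_
    filter_upwards [hg] with k ⟨hlt, hk, _⟩
    rw [hk, integral_withDensity_eq_integral_toReal_smul (hgk k) hlt]
    exact integral_congr_ae (ae_of_all _ fun x => mul_comm _ _)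
  · filter_upwards [hg, hone, hri.condKernel_ae] with k ⟨hlt, hk, hprim⟩ hk1 hrk
    have hg'i : Integrable (fun x => r (k, x) * (g k x).toReal) V := by
      rw [hk, integrable_withDensity_iff (hgk k) hlt] at hrk
      exact hrk
    refine ⟨?_, hg'i, ?_, ae_of_all _ fun x => rfl⟩
    · by_contra h
      rw [integral_undef h] at hk1
      exact zero_ne_one hk1
    · intro φ hφ
      have hφ' : Integrable (deriv φ) V :=
        ((hφ.1.continuous_deriv (by simp)).integrable_of_hasCompactSupport hφ.2.1.deriv).restrict
      have hmem : ∀ᵐ x ∂V, x ∈ Ioo (0 : ℝ) 1 := ae_restrict_mem measurableSet_Ioo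
      calc ∫ x in Ioo (0 : ℝ) 1, (g k x).toReal * deriv φ x
          = ∫ x, deriv φ x * ∫ t, (Iic x).indicator (fun t => r (k, t)) t ∂M.condKernel k ∂V := by
            refine integral_congr_ae ?_
            filter_upwards [hprim] with x hx
            rw [hx, mul_comm, condPrimitive]
        _ = ∫ t, r (k, t) * ∫ x, (Ici t).indicator (deriv φ) x ∂V ∂M.condKernel k :=
            integral_mul_integral_indicator_Iic hrk hφ'
        _ = ∫ t, - (r (k, t) * (g k t).toReal * φ t) ∂V := by
            conv_lhs => rw [hk, integral_withDensity_eq_integral_toReal_smul (hgk k) hlt]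
            refine integral_congr_ae ?_
            filter_upwards [hmem] with t ht
            rw [integral_indicator_Ici_deriv hφ ht, smul_eq_mul]
            ring
        _ = _ := integral_neg _
end
end

section
/- Let C > 0 be a constant such that the Poincaré inequality ∫_0^1 h(x)² dx ≤ C ∫_0^1 (ḣ(x))² dx holds for all h ∈ W^{1,2}(0,1) with h(0) = 0. Let k ≠ 0 and let g ∈ W^{1,1}(0,1) with g ≥ 0, g(0) = 0, ∫_0^1 g(x) dx = 1, √g ∈ W^{1,2}(0,1), and suppose the per-frequency equipartition identity k² ∫_0^1 g(x) dx = (1/(4k²)) ∫_0^1 (ġ(x))²/g(x) dx holds. Then k⁴ ≥ C^{-1}. -/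
open MeasureTheory Set Filter Topology
open scoped ENNReal

noncomputable section

/-- **Poincaré inequality forces a frequency gap.** If `C > 0` is a Poincaré constant on
`(0,1)` for `W^{1,2}` functions vanishing at `0`, `k ≠ 0`, and `g ∈ W^{1,1}(0,1)` is
nonnegative with `g(0) = 0`, `∫₀¹ g = 1`, `√g ∈ W^{1,2}(0,1)`, satisfying the
per-frequency equipartition identity, then `k⁴ ≥ C⁻¹`. -/
theorem poincare_frequency_gap
    (C : ℝ) (hC : 0 < C)
    (hPoin : ∀ h h' : ℝ → ℝ, ContinuousOn h (Icc (0 : ℝ) 1) →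
      HasWeakDerivOn1D (Ioo (0 : ℝ) 1) h h' →
      MemLp h 2 (volume.restrict (Ioo (0 : ℝ) 1)) →
      MemLp h' 2 (volume.restrict (Ioo (0 : ℝ) 1)) → h 0 = 0 →
      ∫ x in Ioo (0 : ℝ) 1, (h x) ^ 2 ≤ C * ∫ x in Ioo (0 : ℝ) 1, (h' x) ^ 2)
    (k : ℝ) (hk : k ≠ 0)
    (g g' s' : ℝ → ℝ)
    (hg0 : ∀ x, 0 ≤ g x) (hgc : ContinuousOn g (Icc (0 : ℝ) 1)) (hgz : g 0 = 0)
    (hgint : IntegrableOn g (Ioo (0 : ℝ) 1)) (hg'int : IntegrableOn g' (Ioo (0 : ℝ) 1))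
    (hgW : HasWeakDerivOn1D (Ioo (0 : ℝ) 1) g g')
    (hmass : ∫ x in Ioo (0 : ℝ) 1, g x = 1)
    (hsW : HasWeakDerivOn1D (Ioo (0 : ℝ) 1) (fun x => Real.sqrt (g x)) s')
    (hs2mem : MemLp (fun x => Real.sqrt (g x)) 2 (volume.restrict (Ioo (0 : ℝ) 1)))
    (hs'2 : MemLp s' 2 (volume.restrict (Ioo (0 : ℝ) 1)))
    (hchain : ∀ᵐ x ∂(volume.restrict (Ioo (0 : ℝ) 1)), (g' x) ^ 2 / g x = 4 * (s' x) ^ 2)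
    (hequi : k ^ 2 * ∫ x in Ioo (0 : ℝ) 1, g x =
      1 / (4 * k ^ 2) * ∫ x in Ioo (0 : ℝ) 1, (g' x) ^ 2 / g x) :
    C⁻¹ ≤ k ^ 4 := by
  have hP := hPoin _ s' hgc.sqrt hsW hs2mem hs'2 (by simp [hgz])
  simp only [Real.sq_sqrt (hg0 _), hmass] at hP
  rw [integral_congr_ae hchain, integral_const_mul, hmass] at hequi
  have hk2 : k ^ 2 ≠ 0 := pow_ne_zero 2 hk
  have henergy : ∫ x in Ioo (0 : ℝ) 1, (s' x) ^ 2 = k ^ 4 := by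
    field_simp at hequi
    linarith
  rw [henergy] at hP
  rw [inv_eq_one_div, div_le_iff₀ hC]
  linarith
end
end
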